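/- arXiv:2111.10881 — 2 statements merged into one kernel-verified Lean document; each statement's English description precedes it below -/
import Mathlib

section
/- Let (P_I, P_II, Δ, c) be a pushdown parity game system over a finite alphabet 𝔸, inducing the pushdown parity game graph H, and let v₀ be a vertex of H. The set of 𝕀₂-labelled 𝔸-branching trees t : 𝔸* → 𝕀₂ that determine memoryless winning strategies for Player II from v₀ in the parity game over H is recognizable by a nondeterministic parity tree automaton. -/
/-- The maximal color occurring infinitely often in the sequence `s` exists and is even. -/
def MaxInfEven (s : ℕ → ℕ) : Prop :=
  ∃ m, Even m ∧ {k | s k = m}.Infinite ∧ ∀ m', {k | s k = m'}.Infinite → m' ≤ m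

/-- The two players of an infinite game. -/
inductive Player
  | one
  | two

/-- The opponent of a player. -/
def Player.other : Player → Player
  | .one => .two
  | .two => .one

/-- A parity game graph: every element of `V` is a vertex, owned by a player,
with edge relation `E` and coloring `color`. -/
structure GameGraph (V : Type) where
  owner : V → Player
  E : V → V → Prop
  color : V → ℕ

/-- The play `π` is won by player `p`: for Player II this means the maximal color
occurring infinitely often is even, for Player I that it is not. -/
def GameGraph.WonBy {V : Type} (G : GameGraph V) (p : Player) (π : ℕ → V) : Prop :=
  match p with
  | .two => MaxInfEven (fun n => G.color (π n))
  | .one => ¬ MaxInfEven (fun n => G.color (π n))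

/-- The finite prefix `π 0, …, π n` of an infinite sequence, as a list. -/
def hist {V : Type} (π : ℕ → V) (n : ℕ) : List V :=
  List.ofFn (fun i : Fin (n + 1) => π i.val)

/-- Finite play prefixes from `u₀` in which player `p` always moves according to
the strategy `σ` (given as a function from nonempty play prefixes to vertices). -/
inductive ConsHist {V : Type} (G : GameGraph V) (p : Player) (σ : List V → V) (u₀ : V) :
    List V → Prop
  | init : ConsHist G p σ u₀ [u₀]
  | ownStep (l : List V) (v : V) : ConsHist G p σ u₀ l → l.getLast? = some v →
      G.owner v = p → ConsHist G p σ u₀ (l ++ [σ l])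
  | oppStep (l : List V) (v w : V) : ConsHist G p σ u₀ l → l.getLast? = some v →
      G.owner v ≠ p → G.E v w → ConsHist G p σ u₀ (l ++ [w])

/-- `σ` is a (legal) strategy for player `p` from `u₀`: at every play prefix from `u₀`
consistent with `σ` and ending in a vertex of `p`, the prescribed move is along an edge. -/
def IsStrategyFrom {V : Type} (G : GameGraph V) (p : Player) (σ : List V → V) (u₀ : V) : Prop :=
  ∀ l v, ConsHist G p σ u₀ l → l.getLast? = some v → G.owner v = p → G.E v (σ l)

/-- `π` is an infinite play from `u₀`. -/
def IsPlayFrom {V : Type} (G : GameGraph V) (u₀ : V) (π : ℕ → V) : Prop :=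
  π 0 = u₀ ∧ ∀ n, G.E (π n) (π (n + 1))

/-- In the play `π`, player `p` always moves according to the strategy `σ`. -/
def ConsistentPlay {V : Type} (G : GameGraph V) (p : Player) (σ : List V → V) (π : ℕ → V) :
    Prop :=
  ∀ n, G.owner (π n) = p → π (n + 1) = σ (hist π n)

/-- `σ` is a winning strategy for player `p` from `u₀`. -/
def WinningStrategyFrom {V : Type} (G : GameGraph V) (p : Player) (σ : List V → V) (u₀ : V) :
    Prop :=
  IsStrategyFrom G p σ u₀ ∧
    ∀ π, IsPlayFrom G u₀ π → ConsistentPlay G p σ π → G.WonBy p π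

/-- The strategy induced by a memoryless strategy `f` (depending only on the last vertex). -/
def liftMemoryless {V : Type} (f : V → V) (u₀ : V) : List V → V :=
  fun l => f (l.getLast?.getD u₀)

/-- The memoryless strategy `f` is a winning strategy for player `p` from `u₀`. -/
def MemorylessWinningFrom {V : Type} (G : GameGraph V) (p : Player) (f : V → V) (u₀ : V) :
    Prop :=
  WinningStrategyFrom G p (liftMemoryless f u₀) u₀

/-- The winning region of player `p`: the vertices from which `p` has a winning strategy. -/
def WinningRegion {V : Type} (G : GameGraph V) (p : Player) : Set V :=
  {u | ∃ σ, WinningStrategyFrom G p σ u}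

/-- A pushdown rule `a p → v q`: `pop = some a` means the rule `a p → v q` with
`a ∈ A`, and `pop = none` means the bottom rule `⊥ p → ⊥ v q`. -/
structure PDRule (A P : Type) where
  pop : Option A
  src : P
  push : List A
  dst : P

/-- The rule `r` is applicable at the vertex `v = (w, p)` and yields the vertex `v'`:
for `pop = some a`, `v = (w a, p)` and `v' = (w ++ push, q)` (top of stack at the right
end); for `pop = none`, `v = (ε, p)` and `v' = (push, q)`. -/
def RuleStep {A P : Type} (r : PDRule A P) (v v' : List A × P) : Prop :=
  r.src = v.2 ∧ r.dst = v'.2 ∧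
    ((∃ (w : List A) (a : A), r.pop = some a ∧ v.1 = w ++ [a] ∧ v'.1 = w ++ r.push) ∨
      (r.pop = none ∧ v.1 = [] ∧ v'.1 = r.push))

/-- The pushdown parity game graph induced by the pushdown parity game system
`(pOwner, Δ, c)` over `A`: vertices are pairs (stack content, control state). -/
def pushdownGame {A P : Type} (pOwner : P → Player) (Δ : Finset (PDRule A P)) (c : P → ℕ) :
    GameGraph (List A × P) :=
  ⟨fun v => pOwner v.2, fun v v' => ∃ r ∈ Δ, RuleStep r v v', fun v => c v.2⟩

/-- The vertices arising in some play from `v₀` in which player `p` moves according to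
the memoryless strategy `f`. -/
inductive Reach {V : Type} (G : GameGraph V) (p : Player) (f : V → V) (v₀ : V) : V → Prop
  | base : Reach G p f v₀ v₀
  | ownStep {v : V} : Reach G p f v₀ v → G.owner v = p → Reach G p f v₀ (f v)
  | oppStep {v w : V} : Reach G p f v₀ v → G.owner v ≠ p → G.E v w → Reach G p f v₀ w

/-- The tree `t` of instructions determines the memoryless strategy `f` of player `pl`
from `v₀`: at every vertex `(w, p)` of player `pl` arising in a play from `v₀` following
`f`, the rule `[t w] p` (a rule of `Δ`) is applicable and yields the vertex `f (w, p)`. -/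
def Determines {A P : Type} (pOwner : P → Player) (Δ : Finset (PDRule A P)) (c : P → ℕ)
    (pl : Player)
    (t : List A → ({p : P // pOwner p = pl} → {r : PDRule A P // r ∈ Δ}))
    (f : List A × P → List A × P) (v₀ : List A × P) : Prop :=
  ∀ v : List A × P, Reach (pushdownGame pOwner Δ c) pl f v₀ v →
    ∀ h : pOwner v.2 = pl, RuleStep (t v.1 ⟨v.2, h⟩).val v (f v)

/-- The nondeterministic parity tree automaton with states `Fin n`, initial state `s0`,
transition relation `ΔB` and coloring `col` accepts the `I`-labelled `A`-branching tree
`t`: there is a run `r` such that on every infinite branch the maximal color occurring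
infinitely often is even. -/
def NPTAAccepts {A I : Type} {n : ℕ} (s0 : Fin n) (ΔB : Set (Fin n × I × (A → Fin n)))
    (col : Fin n → ℕ) (t : List A → I) : Prop :=
  ∃ r : List A → Fin n, r [] = s0 ∧
    (∀ w, (r w, t w, fun a => r (w ++ [a])) ∈ ΔB) ∧
    ∀ b : ℕ → A, MaxInfEven (fun k => col (r (List.ofFn fun i : Fin k => b i.val)))

namespace PushdownParity

theorem exists_gt_of_infinite {p : ℕ → Prop} (h : {k | p k}.Infinite) (K : ℕ) :
    ∃ k, K < k ∧ p k := by
  obtain ⟨k, hk, hk'⟩ := h.exists_gt K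
  exact ⟨k, hk', hk⟩

theorem infinite_of_exists_ge {p : ℕ → Prop} (h : ∀ K, ∃ k, K ≤ k ∧ p k) :
    {k | p k}.Infinite := by
  refine Set.infinite_of_forall_exists_gt fun K => ?_
  obtain ⟨k, hk, hp⟩ := h (K + 1)
  exact ⟨k, hp, hk⟩

theorem exists_eventual_max {s : ℕ → ℕ} {B : ℕ} (hB : ∀ k, s k ≤ B) :
    ∃ m, {k | s k = m}.Infinite ∧ ∃ K, ∀ k, K ≤ k → s k ≤ m := by
  classical
  have hex : ∃ m, ∃ K, ∀ k, K ≤ k → s k ≤ m := ⟨B, 0, fun k _ => hB k⟩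
  obtain ⟨K, hK⟩ := Nat.find_spec hex
  refine ⟨Nat.find hex, infinite_of_exists_ge fun K' => ?_, K, hK⟩
  by_contra! hne
  have hlt : ∀ k, max K K' ≤ k → s k < Nat.find hex := fun k hk =>
    lt_of_le_of_ne (hK k (le_trans (le_max_left _ _) hk))
      (hne k (le_trans (le_max_right _ _) hk))
  have hpos := hlt _ le_rfl
  refine Nat.find_min hex (m := Nat.find hex - 1) (by omega) ⟨max K K', fun k hk => ?_⟩
  have := hlt k hk
  omega

theorem maxInfEven_iff_even {s : ℕ → ℕ} {m K : ℕ} (hm : {k | s k = m}.Infinite)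
    (hK : ∀ k, K ≤ k → s k ≤ m) : MaxInfEven s ↔ Even m := by
  have key : ∀ m', {k | s k = m'}.Infinite → m' ≤ m := fun m' h => by
    obtain ⟨k, hk, rfl⟩ := exists_gt_of_infinite h K
    exact hK k hk.le
  constructor
  · rintro ⟨m', he, hi, hmax⟩
    rwa [le_antisymm (hmax m hm) (key m' hi)]
  · exact fun he => ⟨m, he, hm, key⟩

theorem maxInfEven_congr_of_pos {s s' : ℕ → ℕ} (h : ∀ k, 0 < k → s k = s' k)
    (hs : MaxInfEven s) : MaxInfEven s' := by
  have key : ∀ {u u' : ℕ → ℕ}, (∀ k, 0 < k → u k = u' k) → ∀ m,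
      {k | u k = m}.Infinite → {k | u' k = m}.Infinite := fun hu m hi =>
    infinite_of_exists_ge fun K => by
      obtain ⟨k, hk, hp⟩ := exists_gt_of_infinite hi K
      exact ⟨k, hk.le, (hu k (by omega)).symm.trans hp⟩
  obtain ⟨m, he, hi, hmax⟩ := hs
  exact ⟨m, he, key h m hi, fun m' hm' => hmax m' (key (fun k hk => (h k hk).symm) m' hm')⟩

/-- The labelling `age` identifies exactly the elements of equal value. -/
def AgeOf {Q : Type} (ρ : Q → Ordinal.{0}) (age : Q → ℕ) : Prop :=
  ∀ q q', age q = age q' ↔ ρ q = ρ q'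

/-- One step of the appearance record. The values `ρ`, ranked by seniority `age`, are replaced by
the values `ρ'`, ranked by `age'`. All values more senior than `N - (κ + 1) / 2` persist with their
seniority; if `κ` is even then all values of seniority at least `N - κ / 2` are promoted. -/
structure RecordStep {Q : Type} (N : ℕ) (ρ : Q → Ordinal.{0}) (age : Q → ℕ)
    (ρ' : Q → Ordinal.{0}) (age' : Q → ℕ) (κ : ℕ) : Prop where
  floor : ∀ q y, ρ' y ≤ ρ q → ∃ q', ρ' y ≤ ρ' q' ∧ ρ' q' ≤ ρ q ∧ age' q' ≤ age q ∧
    (Even κ → N - κ / 2 ≤ age q → age' q' < age q)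
  persist : ∀ q, age q < N - (κ + 1) / 2 → ∃ q', age' q' = age q ∧ ρ' q' = ρ q

/-- An accepted sequence of appearance records carries no descending thread of values that
descends strictly infinitely often. -/
theorem no_descending_thread {Q : Type} {N : ℕ} {le : ℕ → Q → Q → Prop} {age : ℕ → Q → ℕ}
    {κ : ℕ → ℕ} {B : ℕ} (hB : ∀ k, κ k ≤ B) (hκ : MaxInfEven κ) {th : ℕ → Q} {strict : ℕ → Prop}
    (hstrict : {k | strict k}.Infinite)
    (hstep : ∀ k, ∃ ρ ρ' : Q → Ordinal.{0}, (∀ q q', le k q q' ↔ ρ q ≤ ρ q') ∧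
      (∀ q q', le (k + 1) q q' ↔ ρ' q ≤ ρ' q') ∧ AgeOf ρ (age k) ∧ AgeOf ρ' (age (k + 1)) ∧
      RecordStep N ρ (age k) ρ' (age (k + 1)) (κ (k + 1)) ∧
      ρ' (th (k + 1)) ≤ ρ (th k) ∧ (strict k → ρ' (th (k + 1)) < ρ (th k))) : False := by
  classical
  obtain ⟨m, hmi, K, hK⟩ := exists_eventual_max hB
  have hme := (maxInfEven_iff_even hmi hK).1 hκ
  set e := N - m / 2 with he
  -- positions below `e` whose value dominates the thread
  let C : ℕ → Finset ℕ := fun k =>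
    (Finset.range e).filter fun i => ∃ q, age k q = i ∧ le k (th k) q
  have hfrozen : ∀ k, K ≤ k → e ≤ N - (κ (k + 1) + 1) / 2 := fun k hk => by
    have := hK (k + 1) (by omega)
    obtain ⟨x, rfl⟩ := hme
    omega
  have hCmono : ∀ k, K ≤ k → C k ⊆ C (k + 1) := by
    intro k hk i hi
    obtain ⟨ρ, ρ', h1, h2, -, -, hr, hle, -⟩ := hstep k
    simp only [C, Finset.mem_filter, Finset.mem_range] at hi ⊢
    obtain ⟨hie, q, rfl, hq⟩ := hi
    obtain ⟨q', hq', hv⟩ := hr.persist q (lt_of_lt_of_le hie (hfrozen k hk))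
    refine ⟨hie, q', hq', (h2 _ _).2 ?_⟩
    rw [hv]
    exact hle.trans ((h1 _ _).1 hq)
  obtain ⟨K₁, hK₁, hC⟩ : ∃ K₁, K ≤ K₁ ∧ ∀ k, K₁ ≤ k → C k = C (k + 1) := by
    have hm : Monotone fun n => (C (K + n)).card := monotone_nat_of_le_succ fun n =>
      Finset.card_le_card (hCmono (K + n) (by omega))
    obtain ⟨B, -, n, hn⟩ : ∃ B, True ∧ ∃ n, ∀ n', n ≤ n' → (C (K + n')).card = B := by
      obtain ⟨B, hB, n, hn⟩ := exists_eventual_max (s := fun n => (C (K + n)).card) (B := e)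
        fun n => (Finset.card_filter_le _ _).trans (by simp)
      obtain ⟨n₁, h₁, h₂⟩ := exists_gt_of_infinite hB n
      refine ⟨B, trivial, n₁, fun n' hn' => le_antisymm (hn n' (by omega)) ?_⟩
      rw [← h₂]
      exact hm hn'
    refine ⟨K + n, by omega, fun k hk => Finset.eq_of_subset_of_card_le (hCmono k (by omega)) ?_⟩
    have e1 := hn (k - K) (by omega)
    have e2 := hn (k + 1 - K) (by omega)
    rw [show K + (k - K) = k by omega] at e1
    rw [show K + (k + 1 - K) = k + 1 by omega] at e2
    omega
  -- the elements above the thread and strictly below all frozen positions above the thread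
  let T : ℕ → Q → Prop := fun k q => le k (th k) q ∧
    ∀ q₁, age k q₁ < e → le k (th k) q₁ → ¬ le k q₁ q
  have hTstep : ∀ k, K₁ ≤ k → ∀ q, T k q → ∃ q', T (k + 1) q' ∧ age (k + 1) q' ≤ age k q ∧
      (κ (k + 1) = m → age (k + 1) q' < age k q) := by
    rintro k hk q ⟨hq, hq₁⟩
    obtain ⟨ρ, ρ', h1, h2, -, ha2, hr, hle, -⟩ := hstep k
    obtain ⟨q', hq', hq'', hage, hlt⟩ := hr.floor q (th (k + 1)) (hle.trans ((h1 _ _).1 hq))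
    refine ⟨q', ⟨(h2 _ _).2 hq', fun q₁' hq₁' hle₁ => ?_⟩, hage, fun hm => hlt (hm ▸ hme) ?_⟩
    · have hmem : age (k + 1) q₁' ∈ C k := by
        rw [hC k hk]
        simp only [C, Finset.mem_filter, Finset.mem_range]
        exact ⟨hq₁', q₁', rfl, hle₁⟩
      simp only [C, Finset.mem_filter, Finset.mem_range] at hmem
      obtain ⟨-, q₂, hq₂, hle₂⟩ := hmem
      have hlt₂ := hq₁ q₂ (hq₂ ▸ hq₁') hle₂
      obtain ⟨q₃, hq₃, hv₃⟩ := hr.persist q₂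
        (lt_of_lt_of_le (hq₂ ▸ hq₁') (hfrozen k (by omega)))
      rw [h1, not_le] at hlt₂
      rw [h2, not_le, ← (ha2 q₃ q₁').1 (hq₃.trans hq₂), hv₃]
      exact hq''.trans_lt hlt₂
    · rw [hm]
      by_contra! hcon
      exact hq₁ q hcon hq ((h1 _ _).2 le_rfl)
  obtain ⟨k₀, hk₀, hs₀⟩ := exists_gt_of_infinite hstrict K₁
  have hT₀ : T (k₀ + 1) (th (k₀ + 1)) := by
    obtain ⟨ρ, ρ', h1, h2, -, ha2, hr, hle, hlt⟩ := hstep k₀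
    refine ⟨(h2 _ _).2 le_rfl, fun q₁ hq₁ hle₁ => ?_⟩
    have hmem : age (k₀ + 1) q₁ ∈ C k₀ := by
      rw [hC k₀ hk₀.le]
      simp only [C, Finset.mem_filter, Finset.mem_range]
      exact ⟨hq₁, q₁, rfl, hle₁⟩
    simp only [C, Finset.mem_filter, Finset.mem_range] at hmem
    obtain ⟨-, q₂, hq₂, hle₂⟩ := hmem
    obtain ⟨q₃, hq₃, hv₃⟩ := hr.persist q₂
      (lt_of_lt_of_le (hq₂ ▸ hq₁) (hfrozen k₀ (by omega)))
    rw [h2, not_le, ← (ha2 q₃ q₁).1 (hq₃.trans hq₂), hv₃]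
    exact (hlt hs₀).trans_le ((h1 _ _).1 hle₂)
  have hdesc : ∀ n k q, K₁ ≤ k → T k q → age k q = n → False := by
    intro n
    induction n using Nat.strong_induction_on with
    | _ n ih =>
      intro k q hk hT hn
      obtain ⟨k', hk', hm⟩ := exists_gt_of_infinite hmi k
      have hreach : ∀ d, ∃ q', T (k + d) q' ∧ age (k + d) q' ≤ n := by
        intro d
        induction d with
        | zero => exact ⟨q, hT, hn.le⟩
        | succ d ihd =>
          obtain ⟨q', hT', hq'⟩ := ihd
          obtain ⟨q'', hT'', hq'', -⟩ := hTstep (k + d) (by omega) q' hT'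
          exact ⟨q'', hT'', hq''.trans hq'⟩
      obtain ⟨q', hT', hq'⟩ := hreach (k' - 1 - k)
      rw [show k + (k' - 1 - k) = k' - 1 by omega] at hT' hq'
      obtain ⟨q'', hT'', -, hlt⟩ := hTstep (k' - 1) (by omega) q' hT'
      rw [show k' - 1 + 1 = k' by omega] at hT'' hlt
      have := hlt hm
      exact ih (age k' q'') (by omega) k' q'' (by omega) hT'' rfl
  exact hdesc _ _ _ (by omega) hT₀ rfl

/-- A sequence of appearance records of genuine ordinals in which every odd `κ` witnesses a strict
descent of the most senior changing value is accepted. -/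
theorem maxInfEven_of_records {Q : Type} {N : ℕ} {ρ : ℕ → Q → Ordinal.{0}} {age : ℕ → Q → ℕ}
    {κ : ℕ → ℕ} (hκ : ∀ k, κ k ≤ 2 * N) (hage : ∀ k, AgeOf (ρ k) (age k))
    (hstep : ∀ k, RecordStep N (ρ k) (age k) (ρ (k + 1)) (age (k + 1)) (κ (k + 1)))
    (hodd : ∀ k, ¬ Even (κ (k + 1)) → ∃ q q', age k q = N - (κ (k + 1) + 1) / 2 ∧
      age (k + 1) q' = age k q ∧ ρ (k + 1) q' < ρ k q) : MaxInfEven κ := by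
  obtain ⟨m, hmi, K, hK⟩ := exists_eventual_max hκ
  rw [maxInfEven_iff_even hmi hK]
  by_contra hme
  have hmN : m ≤ 2 * N := by
    obtain ⟨k, -, rfl⟩ := exists_gt_of_infinite hmi 0
    exact hκ k
  have hnext : ∀ k, K ≤ k → ∀ q, age k q = N - (m + 1) / 2 →
      ∃ q', age (k + 1) q' = N - (m + 1) / 2 ∧ ρ (k + 1) q' ≤ ρ k q ∧
        (κ (k + 1) = m → ρ (k + 1) q' < ρ k q) := by
    intro k hk q hq
    by_cases hm : κ (k + 1) = m
    · obtain ⟨q₁, q', h1, h2, h3⟩ := hodd k (hm ▸ hme)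
      rw [hm] at h1
      rw [(hage k q₁ q).1 (h1.trans hq.symm)] at h3
      exact ⟨q', h2.trans h1, h3.le, fun _ => h3⟩
    · have hlt : κ (k + 1) < m := lt_of_le_of_ne (hK _ (by omega)) hm
      rw [Nat.not_even_iff_odd] at hme
      obtain ⟨x, rfl⟩ := hme
      obtain ⟨q', h1, h2⟩ := (hstep k).persist q (by omega)
      exact ⟨q', h1.trans hq, h2.le, fun h => absurd h hm⟩
  obtain ⟨k₀, hk₀, hm₀⟩ := exists_gt_of_infinite hmi (K + 1)
  obtain ⟨q₀, -, hq₀, -⟩ := hodd (k₀ - 1) (by rw [show k₀ - 1 + 1 = k₀ by omega, hm₀]; exact hme)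
  rw [show k₀ - 1 + 1 = k₀ by omega, hm₀] at hq₀
  have hdesc : ∀ o : Ordinal.{0}, ∀ k q, K ≤ k → age k q = N - (m + 1) / 2 → ρ k q = o →
      False := by
    intro o
    induction o using WellFoundedLT.induction with
    | _ o ih =>
      intro k q hk hq ho
      obtain ⟨k', hk', hm⟩ := exists_gt_of_infinite hmi k
      have hreach : ∀ d, ∃ q', age (k + d) q' = N - (m + 1) / 2 ∧ ρ (k + d) q' ≤ o := by
        intro d
        induction d with
        | zero => exact ⟨q, hq, ho.le⟩
        | succ d ihd =>
          obtain ⟨q', h1, h2⟩ := ihd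
          obtain ⟨q'', h3, h4, -⟩ := hnext (k + d) (by omega) q' h1
          exact ⟨q'', h3, h4.trans h2⟩
      obtain ⟨q', h1, h2⟩ := hreach (k' - 1 - k)
      rw [show k + (k' - 1 - k) = k' - 1 by omega] at h1 h2
      obtain ⟨q'', h3, -, h4⟩ := hnext (k' - 1) (by omega) q' h1
      rw [show k' - 1 + 1 = k' by omega] at h3 h4
      exact ih _ ((h4 hm).trans_le h2) k' q'' (by omega) h3 rfl
  exact hdesc _ _ _ (by omega) hq₀ rfl

/-- The values `ρ` are ranked by `age` with ranks forming an initial segment of `{0, …, N - 1}`. -/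
structure Ranked {Q : Type} (N : ℕ) (ρ : Q → Ordinal.{0}) (age : Q → ℕ) : Prop where
  ageOf : AgeOf ρ age
  lt : ∀ q, age q < N
  initial : ∀ q i, i < age q → ∃ q', age q' = i

theorem exists_count_eq_of_lt (p : ℕ → Prop) [DecidablePred p] {i n : ℕ}
    (h : i < Nat.count p n) : ∃ k, p k ∧ Nat.count p k = i := by
  induction n with
  | zero => simp at h
  | succ n ih =>
    by_cases hi : i < Nat.count p n
    · exact ih hi
    · rw [Nat.count_succ] at h
      by_cases hp : p n
      · exact ⟨n, hp, by rw [if_pos hp] at h; omega⟩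
      · rw [if_neg hp] at h
        omega

/-- Every ranking evolves along a change of values from `ρ` to `ρ'`. -/
theorem Ranked.exists_step {Q : Type} [Fintype Q] {ρ : Q → Ordinal.{0}} {age : Q → ℕ}
    (h : Ranked (Fintype.card Q) ρ age) (ρ' : Q → Ordinal.{0}) :
    ∃ (age' : Q → ℕ) (κ : ℕ), Ranked (Fintype.card Q) ρ' age' ∧ κ ≤ 2 * Fintype.card Q ∧
      RecordStep (Fintype.card Q) ρ age ρ' age' κ ∧
      (¬ Even κ → ∃ q q', age q = Fintype.card Q - (κ + 1) / 2 ∧ age' q' = age q ∧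
        ρ' q' < ρ q) := by
  classical
  set N := Fintype.card Q with hN
  let IsFloor : Q → Q → Prop := fun q y => ρ' y ≤ ρ q ∧ ∀ z, ρ' z ≤ ρ q → ρ' z ≤ ρ' y
  have floor_unique : ∀ q y z, IsFloor q y → IsFloor q z → ρ' y = ρ' z := fun q y z hy hz =>
    le_antisymm (hz.2 y hy.1) (hy.2 z hz.1)
  have floor_congr : ∀ q₁ q₂ y, age q₁ = age q₂ → IsFloor q₁ y → IsFloor q₂ y := by
    intro q₁ q₂ y hq hy
    have := (h.ageOf q₁ q₂).1 hq
    simpa only [IsFloor, this] using hy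
  have floor_congr' : ∀ q y z, ρ' y = ρ' z → IsFloor q y → IsFloor q z := by
    intro q y z hq hy
    simpa only [IsFloor, hq] using hy
  have exists_floor : ∀ q y, ρ' y ≤ ρ q → ∃ z, IsFloor q z := by
    intro q y hy
    obtain ⟨z, hz, hmax⟩ := (Finset.univ.filter fun z => ρ' z ≤ ρ q).exists_max_image ρ'
      ⟨y, by simpa using hy⟩
    exact ⟨z, by simpa using hz, fun x hx => hmax x (by simpa using hx)⟩
  -- seniority claimed by each new value: inherited from the most senior value it replaces
  obtain ⟨key, key_eq, key_le, key_lt⟩ : ∃ key : Q → ℕ,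
      (∀ y z, key y = key z ↔ ρ' y = ρ' z) ∧ (∀ q y, IsFloor q y → key y ≤ age q) ∧
      ∀ y, key y < N → ∃ q, IsFloor q y ∧ age q = key y := by
    let rk : Q → ℕ := fun y => (Finset.univ.filter fun z => ρ' z < ρ' y).card
    have hrk : ∀ y z, ρ' y < ρ' z → rk y < rk z := fun y z hyz => by
      refine Finset.card_lt_card ⟨fun x hx => ?_, fun hsub => ?_⟩
      · simp only [Finset.mem_filter, Finset.mem_univ, true_and] at hx ⊢
        exact hx.trans hyz
      · simpa using hsub (show y ∈ _ by simpa using hyz)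
    have hmin : ∀ y, (∃ q, IsFloor q y) →
        ∃ q, IsFloor q y ∧ ∀ q', IsFloor q' y → age q ≤ age q' := by
      rintro y ⟨q, hq⟩
      obtain ⟨z, hz, hm⟩ := (Finset.univ.filter fun q => IsFloor q y).exists_min_image age
        ⟨q, by simpa using hq⟩
      exact ⟨z, by simpa using hz, fun x hx => hm x (by simpa using hx)⟩
    choose! src hsrc hsrc' using hmin
    refine ⟨fun y => if ∃ q, IsFloor q y then age (src y) else N + rk y, ?_, ?_, ?_⟩
    · intro y z
      by_cases hy : ∃ q, IsFloor q y <;> by_cases hz : ∃ q, IsFloor q z <;>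
        simp only [hy, hz, if_true, if_false]
      · constructor
        · intro heq
          exact floor_unique (src z) y z (floor_congr _ _ _ heq (hsrc y hy)) (hsrc z hz)
        · intro heq
          exact le_antisymm (hsrc' y hy _ (floor_congr' _ _ _ heq.symm (hsrc z hz)))
            (hsrc' z hz _ (floor_congr' _ _ _ heq (hsrc y hy)))
      · refine ⟨fun heq => ?_, fun heq => ?_⟩
        · have := h.lt (src y)
          omega
        · obtain ⟨q, hq⟩ := hy
          exact absurd ⟨q, floor_congr' _ _ _ heq hq⟩ hz
      · refine ⟨fun heq => ?_, fun heq => ?_⟩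
        · have := h.lt (src z)
          omega
        · obtain ⟨q, hq⟩ := hz
          exact absurd ⟨q, floor_congr' _ _ _ heq.symm hq⟩ hy
      · refine ⟨fun heq => ?_, fun heq => ?_⟩
        · rcases lt_trichotomy (ρ' y) (ρ' z) with hlt | heq' | hlt
          · have := hrk _ _ hlt
            omega
          · exact heq'
          · have := hrk _ _ hlt
            omega
        · simp only [rk, heq]
    · intro q y hq
      simp only [if_pos (⟨q, hq⟩ : ∃ q, IsFloor q y)]
      exact hsrc' y ⟨q, hq⟩ q hq
    · intro y hy
      by_cases hy' : ∃ q, IsFloor q y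
      · exact ⟨src y, hsrc y hy', by simp [hy']⟩
      · simp [hy'] at hy
  let p : ℕ → Prop := fun i => ∃ z, key z = i
  let age' : Q → ℕ := fun y => Nat.count p (key y)
  have age'_le : ∀ y, age' y ≤ key y := fun y => Nat.count_le p
  have age'_eq : ∀ y, (∀ i, i < key y → ∃ z, key z = i) → age' y = key y := fun y hy =>
    Nat.count_iff_forall.2 fun i hi => hy i hi
  have hranked : Ranked N ρ' age' := by
    refine ⟨fun y z => ?_, fun y => ?_, fun y i hi => ?_⟩
    · rw [← key_eq]
      exact ⟨fun heq => Nat.count_injective ⟨y, rfl⟩ ⟨z, rfl⟩ heq, fun heq => by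
        simp only [age', heq]⟩
    · have hsub : (Finset.range (key y)).filter p ⊆ (Finset.univ.image key).erase (key y) := by
        intro i hi
        simp only [Finset.mem_filter, Finset.mem_range] at hi
        obtain ⟨hi, z, rfl⟩ := hi
        simp [hi.ne]
      have h1 := Finset.card_le_card hsub
      have h2 := Finset.card_erase_lt_of_mem
        (Finset.mem_image_of_mem key (Finset.mem_univ y))
      have h3 : (Finset.univ.image key).card ≤ N := Finset.card_image_le
      simp only [age', Nat.count_eq_card_filter_range]
      exact (h1.trans_lt h2).trans_le h3
    · obtain ⟨k, ⟨z, rfl⟩, hk⟩ := exists_count_eq_of_lt p hi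
      exact ⟨z, hk⟩
  have hfloor : ∀ q y, ρ' y ≤ ρ q → ∃ q', ρ' y ≤ ρ' q' ∧ ρ' q' ≤ ρ q ∧ key q' ≤ age q := by
    intro q y hy
    obtain ⟨z, hz⟩ := exists_floor q y hy
    exact ⟨z, hz.2 y hy, hz.1, key_le q z hz⟩
  -- the most senior vanishing value
  let Stays : Q → Prop := fun q => ∃ q', ρ' q' = ρ q
  have stays_key : ∀ q, (∀ q₁, age q₁ ≤ age q → Stays q₁) →
      ∃ q', key q' = age q ∧ ρ' q' = ρ q := by
    intro q hq
    obtain ⟨q', hq'⟩ := hq q le_rfl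
    have hle : key q' ≤ age q := key_le q q' ⟨hq'.le, fun z hz => hz.trans hq'.ge⟩
    obtain ⟨q₁, hq₁, hage⟩ := key_lt q' (hle.trans_lt (h.lt q))
    obtain ⟨q₁', hq₁'⟩ := hq q₁ (hage ▸ hle)
    have : ρ q₁ = ρ q := by
      rw [← hq', ← hq₁']
      exact floor_unique q₁ _ _ ⟨hq₁'.le, fun z hz => hz.trans hq₁'.ge⟩ hq₁
    exact ⟨q', by rw [← hage, (h.ageOf q₁ q).2 this], hq'⟩
  have stays_age : ∀ q, (∀ q₁, age q₁ ≤ age q → Stays q₁) →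
      ∃ q', age' q' = age q ∧ ρ' q' = ρ q := by
    intro q hq
    obtain ⟨q', h1, h2⟩ := stays_key q hq
    refine ⟨q', ?_, h2⟩
    rw [age'_eq q', h1]
    intro i hi
    obtain ⟨q₁, rfl⟩ := h.initial q i (h1 ▸ hi)
    obtain ⟨z, hz, -⟩ := stays_key q₁ fun q₂ hq₂ => hq q₂ (by omega)
    exact ⟨z, hz⟩
  by_cases hall : ∀ q, Stays q
  · refine ⟨age', 0, hranked, by omega, ⟨fun q y hy => ?_, fun q _ => ?_⟩, by simp⟩
    · obtain ⟨q', h1, h2, h3⟩ := hfloor q y hy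
      refine ⟨q', h1, h2, (age'_le _).trans h3, fun _ hle => ?_⟩
      have := h.lt q
      omega
    · exact stays_age q fun q₁ _ => hall q₁
  push Not at hall
  obtain ⟨v, hv, hvmin⟩ : ∃ v, ¬ Stays v ∧ ∀ q, age q < age v → Stays q := by
    obtain ⟨q, hq⟩ := hall
    obtain ⟨v, hv, hm⟩ := (Finset.univ.filter fun q => ¬ Stays q).exists_min_image age
      ⟨q, by simpa using hq⟩
    refine ⟨v, by simpa using hv, fun q hlt => ?_⟩
    by_contra hcon
    exact absurd (hm q (by simpa using hcon)) (by omega)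
  have hvN := h.lt v
  have hpersist : ∀ q, age q < age v → ∃ q', age' q' = age q ∧ ρ' q' = ρ q := fun q hq =>
    stays_age q fun q₁ hq₁ => hvmin q₁ (by omega)
  have hkeys : ∀ i, i < age v → ∃ z, key z = i := by
    intro i hi
    obtain ⟨q, rfl⟩ := h.initial v i hi
    obtain ⟨z, hz, -⟩ := stays_key q fun q₁ hq₁ => hvmin q₁ (by omega)
    exact ⟨z, hz⟩
  by_cases hflash : ∃ z, key z = age v
  · obtain ⟨z, hz⟩ := hflash
    refine ⟨age', 2 * (N - age v) - 1, hranked, by omega,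
      ⟨fun q y hy => ?_, fun q hq => hpersist q (by omega)⟩, fun _ => ?_⟩
    · obtain ⟨q', h1, h2, h3⟩ := hfloor q y hy
      refine ⟨q', h1, h2, (age'_le _).trans h3, fun heven => ?_⟩
      obtain ⟨x, hx⟩ := heven
      omega
    · obtain ⟨q, hq, hage⟩ := key_lt z (by omega)
      refine ⟨v, z, by omega, ?_, ?_⟩
      · rw [age'_eq z (hz ▸ hkeys), hz]
      · have hle := (floor_congr q v z (hage.trans hz) hq).1
        exact lt_of_le_of_ne hle fun heq => hv ⟨z, heq⟩
  · refine ⟨age', 2 * (N - age v), hranked, by omega,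
      ⟨fun q y hy => ?_, fun q hq => hpersist q (by omega)⟩, by simp⟩
    obtain ⟨q', h1, h2, h3⟩ := hfloor q y hy
    refine ⟨q', h1, h2, (age'_le _).trans h3, fun _ hle => ?_⟩
    rcases lt_or_ge (age v) (key q') with hlt | hge
    · have hne : age' q' ≠ key q' := fun heq => hflash (Nat.count_iff_forall.1 heq _ hlt)
      have := age'_le q'
      omega
    · have hne : key q' ≠ age v := fun heq => hflash ⟨q', heq⟩
      have := age'_le q'
      omega

/-- Every assignment of values has a ranking. -/
theorem exists_ranked {Q : Type} [Fintype Q] (ρ : Q → Ordinal.{0}) :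
    ∃ age : Q → ℕ, Ranked (Fintype.card Q) ρ age := by
  have h₀ : Ranked (Fintype.card Q) (fun _ : Q => (0 : Ordinal.{0})) fun _ => 0 :=
    ⟨fun _ _ => by simp, fun q => Fintype.card_pos_iff.2 ⟨q⟩, fun _ _ h => by simp at h⟩
  obtain ⟨age, -, h, -⟩ := h₀.exists_step ρ
  exact ⟨age, h⟩

variable {A P : Type}

/-- The instructions for Player II. -/
abbrev Instr (pOwner : P → Player) (Δ : Finset (PDRule A P)) : Type :=
  {p : P // pOwner p = Player.two} → {r : PDRule A P // r ∈ Δ}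

/-- The rule `r` may be used in control state `p` under the instruction `ι`. -/
def Allowed {pOwner : P → Player} {Δ : Finset (PDRule A P)} (ι : Instr pOwner Δ) (p : P)
    (r : PDRule A P) : Prop :=
  r ∈ Δ ∧ ∀ h : pOwner p = Player.two, (ι ⟨p, h⟩).val = r

/-- A move of the pushdown game in which Player II follows the instruction tree `t`. -/
def Move {pOwner : P → Player} {Δ : Finset (PDRule A P)} (t : List A → Instr pOwner Δ)
    (v v' : List A × P) : Prop :=
  ∃ r, Allowed (t v.1) v.2 r ∧ RuleStep r v v'

/-- Following `t`, every vertex reached from `v₀` has a move and every play is won by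
Player II. -/
def Good {pOwner : P → Player} {Δ : Finset (PDRule A P)} (c : P → ℕ)
    (t : List A → Instr pOwner Δ) (v₀ : List A × P) : Prop :=
  (∀ v, Relation.ReflTransGen (Move t) v₀ v → ∃ v', Move t v v') ∧
    ∀ π : ℕ → List A × P, π 0 = v₀ → (∀ n, Move t (π n) (π (n + 1))) →
      MaxInfEven fun n => c (π n).2

theorem ruleStep_unique {r : PDRule A P} {v v₁ v₂ : List A × P} (h₁ : RuleStep r v v₁)
    (h₂ : RuleStep r v v₂) : v₁ = v₂ := by
  obtain ⟨-, hd₁, h₁⟩ := h₁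
  obtain ⟨-, hd₂, h₂⟩ := h₂
  refine Prod.ext ?_ (hd₁.symm.trans hd₂)
  rcases h₁ with ⟨w₁, a₁, hp₁, hv₁, hw₁⟩ | ⟨hp₁, hv₁, hw₁⟩ <;>
    rcases h₂ with ⟨w₂, a₂, hp₂, hv₂, hw₂⟩ | ⟨hp₂, hv₂, hw₂⟩
  · have := hv₁.symm.trans hv₂
    rw [hw₁, hw₂, (List.append_inj' this rfl).1]
  · simp [hp₁] at hp₂
  · simp [hp₁] at hp₂
  · rw [hw₁, hw₂]

theorem getLast?_hist {V : Type} (π : ℕ → V) (n : ℕ) : (hist π n).getLast? = some (π n) := by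
  rw [hist, List.ofFn_succ', List.concat_eq_append]
  simp

theorem good_iff {pOwner : P → Player} {Δ : Finset (PDRule A P)} {c : P → ℕ}
    (htot : ∀ v, ∃ w, (pushdownGame pOwner Δ c).E v w) (t : List A → Instr pOwner Δ)
    (v₀ : List A × P) :
    Good c t v₀ ↔ ∃ f : List A × P → List A × P,
      MemorylessWinningFrom (pushdownGame pOwner Δ c) Player.two f v₀ ∧
      Determines pOwner Δ c Player.two t f v₀ := by
  classical
  constructor
  · rintro ⟨hmove, hwin⟩
    let f : List A × P → List A × P := fun v => if h : ∃ v', Move t v v' then h.choose else v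
    have hf : ∀ v, Relation.ReflTransGen (Move t) v₀ v → Move t v (f v) := by
      intro v hv
      have := hmove v hv
      simp only [f, dif_pos this]
      exact this.choose_spec
    have hE : ∀ v v', Move t v v' → (pushdownGame pOwner Δ c).E v v' :=
      fun v v' ⟨r, hr, hs⟩ => ⟨r, hr.1, hs⟩
    have hopp : ∀ v v', pOwner v.2 ≠ Player.two → (pushdownGame pOwner Δ c).E v v' →
        Move t v v' := fun v v' ho ⟨r, hr, hs⟩ => ⟨r, ⟨hr, fun h => absurd h ho⟩, hs⟩
    have hcons : ∀ l, ConsHist (pushdownGame pOwner Δ c) Player.two (liftMemoryless f v₀) v₀ l →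
        ∀ v, l.getLast? = some v → Relation.ReflTransGen (Move t) v₀ v := by
      intro l hl
      induction hl with
      | init => simp only [List.getLast?_singleton, Option.some.injEq]; rintro _ rfl; exact .refl
      | ownStep l v _ hlast _ ih =>
        intro v' hv'
        simp only [List.getLast?_append, List.getLast?_singleton, Option.some_or,
          Option.some.injEq] at hv'
        subst hv'
        simp only [liftMemoryless, hlast, Option.getD_some]
        exact (ih v hlast).tail (hf v (ih v hlast))
      | oppStep l v w _ hlast ho he ih =>
        intro v' hv'
        simp only [List.getLast?_append, List.getLast?_singleton, Option.some_or,
          Option.some.injEq] at hv'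
        subst hv'
        exact (ih v hlast).tail (hopp _ _ ho he)
    refine ⟨f, ⟨fun l v hl hlast _ => ?_, fun π hπ hc => ?_⟩, fun v hv ho => ?_⟩
    · simp only [liftMemoryless, hlast, Option.getD_some]
      exact hE _ _ (hf v (hcons l hl v hlast))
    · have hreach : ∀ n, Relation.ReflTransGen (Move t) v₀ (π n) ∧ Move t (π n) (π (n + 1)) := by
        have hnext : ∀ n, Relation.ReflTransGen (Move t) v₀ (π n) →
            Move t (π n) (π (n + 1)) := by
          intro n hn
          by_cases ho : pOwner (π n).2 = Player.two
          · have := hc n ho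
            simp only [liftMemoryless, getLast?_hist, Option.getD_some] at this
            rw [this]
            exact hf _ hn
          · exact hopp _ _ ho (hπ.2 n)
        intro n
        induction n with
        | zero => rw [hπ.1]; exact ⟨.refl, hπ.1 ▸ hnext 0 (hπ.1 ▸ .refl)⟩
        | succ n ih => exact ⟨ih.1.tail ih.2, hnext _ (ih.1.tail ih.2)⟩
      exact hwin π hπ.1 fun n => (hreach n).2
    · have hv' : Relation.ReflTransGen (Move t) v₀ v := by
        clear ho
        induction hv with
        | base => exact .refl
        | ownStep _ _ ih => exact ih.tail (hf _ ih)
        | oppStep _ ho' he ih => exact ih.tail (hopp _ _ ho' he)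
      obtain ⟨r, hr, hs⟩ := hf v hv'
      rwa [hr.2 ho]
  · rintro ⟨f, ⟨hstrat, hwin⟩, hdet⟩
    have hf : ∀ v, Reach (pushdownGame pOwner Δ c) Player.two f v₀ v → pOwner v.2 = Player.two →
        ∀ v', Move t v v' → v' = f v := by
      rintro v hv ho v' ⟨r, hr, hs⟩
      have := hdet v hv ho
      rw [hr.2 ho] at this
      exact ruleStep_unique hs this
    have hreach : ∀ v, Relation.ReflTransGen (Move t) v₀ v →
        Reach (pushdownGame pOwner Δ c) Player.two f v₀ v := by
      intro v hv
      induction hv with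
      | refl => exact .base
      | @tail v v' _ hm ih =>
        by_cases ho : pOwner v.2 = Player.two
        · rw [hf v ih ho v' hm]
          exact .ownStep ih ho
        · obtain ⟨r, hr, hs⟩ := hm
          exact .oppStep ih ho ⟨r, hr.1, hs⟩
    refine ⟨fun v hv => ?_, fun π hπ hm => ?_⟩
    · by_cases ho : pOwner v.2 = Player.two
      · exact ⟨f v, _, ⟨(t v.1 ⟨v.2, ho⟩).2, fun _ => rfl⟩, hdet v (hreach v hv) ho⟩
      · obtain ⟨w, r, hr, hs⟩ := htot v
        exact ⟨w, r, ⟨hr, fun h => absurd h ho⟩, hs⟩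
    · have hr : ∀ n, Relation.ReflTransGen (Move t) v₀ (π n) := by
        intro n
        induction n with
        | zero => rw [hπ]
        | succ n ih => exact ih.tail (hm n)
      refine hwin π ⟨hπ, fun n => ?_⟩ fun n ho => ?_
      · obtain ⟨r, hr, hs⟩ := hm n
        exact ⟨r, hr.1, hs⟩
      · simp only [liftMemoryless, getLast?_hist, Option.getD_some]
        exact hf _ (hreach _ (hr n)) ho _ (hm n)

/-- A tree automaton with an arbitrary finite set of states and a condition on the state and
label of the root recognizes a language recognizable with a single initial state. -/
theorem exists_npta {I S : Type} [Finite S] (root : S → Prop) (T : Set (S × I × (A → S)))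
    (col : S → ℕ) :
    ∃ (n : ℕ) (s0 : Fin n) (ΔB : Set (Fin n × I × (A → Fin n))) (col' : Fin n → ℕ),
      ∀ t : List A → I, NPTAAccepts s0 ΔB col' t ↔
        ∃ r : List A → S, root (r []) ∧ (∀ w, (r w, t w, fun a => r (w ++ [a])) ∈ T) ∧
          ∀ b : ℕ → A, MaxInfEven fun k => col (r (List.ofFn fun i : Fin k => b i.val)) := by
  classical
  obtain ⟨n, ⟨e⟩⟩ := Finite.exists_equiv_fin (Option S)
  refine ⟨n, e none, {x | ∃ (s : S) (g : A → S), (s, x.2.1, g) ∈ T ∧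
    (x.1 = e (some s) ∨ x.1 = e none ∧ root s) ∧ x.2.2 = fun a => e (some (g a))},
    fun i => ((e.symm i).map col).getD 0, fun t => ⟨?_, ?_⟩⟩
  · rintro ⟨r, h0, hr, hacc⟩
    choose s g hT hs hg using hr
    have hchild : ∀ w a, s (w ++ [a]) = g w a := by
      intro w a
      have h1 : r (w ++ [a]) = e (some (g w a)) := congrFun (hg w) a
      rcases hs (w ++ [a]) with h2 | ⟨h2, -⟩
      · simpa using h2.symm.trans h1
      · simpa using h2.symm.trans h1
    have hroot : root (s []) := by
      rcases hs [] with h2 | ⟨-, h2⟩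
      · simpa using h0.symm.trans h2
      · exact h2
    refine ⟨s, hroot, fun w => ?_, fun b => maxInfEven_congr_of_pos (fun k hk => ?_) (hacc b)⟩
    · simpa only [hchild] using hT w
    · obtain ⟨k, rfl⟩ : ∃ k', k = k' + 1 := ⟨k - 1, by omega⟩
      have h1 : r (List.ofFn fun i : Fin (k + 1) => b i) =
          e (some (s (List.ofFn fun i : Fin (k + 1) => b i))) := by
        rw [List.ofFn_succ', List.concat_eq_append, hchild]
        exact congrFun (hg _) _
      simp only [h1, Equiv.symm_apply_apply, Option.map_some, Option.getD_some]
  · rintro ⟨s, hroot, hT, hacc⟩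
    refine ⟨fun w => if w = [] then e none else e (some (s w)), by simp, fun w => ?_,
      fun b => maxInfEven_congr_of_pos (fun k hk => ?_) (hacc b)⟩
    · refine ⟨s w, fun a => s (w ++ [a]), hT w, ?_, by simp⟩
      by_cases hw : w = []
      · subst hw
        simp [hroot]
      · simp [hw]
    · have : (List.ofFn fun i : Fin k => b i) ≠ [] := by
        intro h
        have := congrArg List.length h
        simp at this
        omega
      simp [this]

/-- If no infinite path of `R` is marked infinitely often, the vertices can be ranked by ordinals
that never increase along `R` and strictly decrease at marks. -/
theorem exists_rank {V : Type} (R : V → V → Prop) (mark : V → Prop)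
    (h : ∀ π : ℕ → V, (∀ n, R (π n) (π (n + 1))) → ¬ {n | mark (π n)}.Infinite) :
    ∃ ρ : V → Ordinal.{0}, ∀ v v', R v v' → ρ v' ≤ ρ v ∧ (mark v → ρ v' < ρ v) := by
  classical
  let S : V → V → Prop := fun u v => ∃ x y, Relation.ReflTransGen R v x ∧ mark x ∧ R x y ∧
    Relation.ReflTransGen R y u
  have hS : ∀ u v v', S u v' → R v v' → S u v := fun u v v' ⟨x, y, h1, h2, h3, h4⟩ hR =>
    ⟨x, y, h1.head hR, h2, h3, h4⟩
  have hacc : ∀ v v', Relation.ReflTransGen R v v' → Acc S v → Acc S v' := by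
    intro v v' hv ha
    refine ⟨_, fun u hu => ha.inv ?_⟩
    obtain ⟨x, y, h1, h2⟩ := hu
    exact ⟨x, y, hv.trans h1, h2⟩
  have hwf : WellFounded S := by
    refine ⟨fun v₀ => ?_⟩
    by_contra hv₀
    let Dist : ℕ → V → Prop := fun n => Nat.rec
      (fun v => mark v ∧ ∃ y, R v y ∧ ¬ Acc S y) (fun _ D v => ∃ v', R v v' ∧ D v') n
    have hDacc : ∀ n v, Dist n v → ¬ Acc S v := by
      intro n
      induction n with
      | zero => rintro v ⟨-, y, hy, hy'⟩ ha; exact hy' (hacc v y (.single hy) ha)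
      | succ n ih => rintro v ⟨y, hy, hy'⟩ ha; exact ih y hy' (hacc v y (.single hy) ha)
    have hDex : ∀ v, ¬ Acc S v → ∃ n, Dist n v := by
      intro v hv
      obtain ⟨u, ⟨x, y, h1, h2, h3, h4⟩, hu⟩ : ∃ u, S u v ∧ ¬ Acc S u := by
        by_contra! hcon
        exact hv ⟨_, fun u hu => hcon u hu⟩
      induction h1 using Relation.ReflTransGen.head_induction_on with
      | refl => exact ⟨0, h2, y, h3, fun ha => hu (hacc y u h4 ha)⟩
      | @head a b hab hbx ih =>
        obtain ⟨n, hn⟩ := ih fun ha =>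
          hu (hacc y u h4 (hacc b y (hbx.tail h3) ha))
        exact ⟨n + 1, b, hab, hn⟩
    have hnext : ∀ v : {v // ¬ Acc S v}, ∃ v' : {v // ¬ Acc S v}, R v.1 v'.1 ∧
        (mark v.1 ∨ ∀ n, Dist n v.1 → ∃ n', n' < n ∧ Dist n' v'.1) := by
      rintro ⟨v, hv⟩
      have hex := hDex v hv
      obtain ⟨n, hspec, hmin⟩ : ∃ n, Dist n v ∧ ∀ n', Dist n' v → n ≤ n' :=
        ⟨sInf {n | Dist n v}, Nat.sInf_mem hex, fun n' hn' => Nat.sInf_le hn'⟩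
      rcases n with _ | n
      · obtain ⟨hm, y, hy, hy'⟩ := hspec
        exact ⟨⟨y, hy'⟩, hy, .inl hm⟩
      · obtain ⟨y, hy, hy'⟩ := hspec
        exact ⟨⟨y, hDacc n y hy'⟩, hy, .inr fun n' hn' => ⟨n, hmin n' hn', hy'⟩⟩
    choose next hR hdist using hnext
    let π : ℕ → {v // ¬ Acc S v} := fun n => next^[n] ⟨v₀, hv₀⟩
    have hπ : ∀ n, π (n + 1) = next (π n) := fun n => Function.iterate_succ_apply' _ _ _
    refine h (fun n => (π n).1) (fun n => by simpa only [hπ] using hR (π n))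
      (infinite_of_exists_ge fun K => ?_)
    have key : ∀ n k, K ≤ k → Dist n (π k).1 → ∃ k, K ≤ k ∧ mark (π k).1 := by
      intro n
      induction n using Nat.strong_induction_on with
      | _ n ih =>
        intro k hk hn
        rcases hdist (π k) with hm | hd
        · exact ⟨k, hk, hm⟩
        · obtain ⟨n', hlt, hn'⟩ := hd n hn
          exact ih n' hlt (k + 1) (by omega) (by rw [hπ]; exact hn')
    obtain ⟨n, hn⟩ := hDex _ (π K).2
    exact key n K le_rfl hn
  have : IsWellFounded V S := ⟨hwf⟩
  refine ⟨IsWellFounded.rank S, fun v v' hR => ⟨?_, fun hm => ?_⟩⟩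
  · rw [IsWellFounded.rank_eq S v']
    exact Ordinal.iSup_le fun u =>
      Order.succ_le_of_lt (IsWellFounded.rank_lt_of_rel (hS u.1 v v' u.2 hR))
  · exact IsWellFounded.rank_lt_of_rel ⟨v, v', .refl, hm, hR, .refl⟩

/-- Stack contents of length at most `L`. -/
abbrev Pend (A : Type) (L : ℕ) : Type := {u : List A // u.length ≤ L}

section Thread

variable {L K : ℕ} {w : ℕ → List A} {p : ℕ → P} {mark : ℕ → Prop}
  {val : List A → P → Pend A L → Ordinal.{0}}

/-- Along a segment of a play whose stack stays above `x`, the values at `x` descend. -/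
theorem excursion (hL : 1 ≤ L)
    (hpush : ∀ n, ∃ u : Pend A L, w (n + 1) = (w n).dropLast ++ u.1)
    (hshift : ∀ x a p₁ p₂ (u₁ u₂ v₁ v₂ : Pend A L), u₁.1 = a :: v₁.1 → u₂.1 = a :: v₂.1 →
      (val x p₁ u₁ ≤ val x p₂ u₂ ↔ val (x ++ [a]) p₁ v₁ ≤ val (x ++ [a]) p₂ v₂))
    (hstep : ∀ n, K ≤ n → ∀ u u' : Pend A L, w n = (w n).dropLast ++ u.1 →
      w (n + 1) = (w n).dropLast ++ u'.1 →
      val (w n).dropLast (p (n + 1)) u' ≤ val (w n).dropLast (p n) u ∧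
        (mark n → val (w n).dropLast (p (n + 1)) u' < val (w n).dropLast (p n) u))
    (i k : ℕ) (x : List A) (u u' : Pend A L) (hi : K ≤ i) (hik : i ≤ k)
    (hx : ∀ n, i ≤ n → n < k → x <+: (w n).dropLast) (hu : w i = x ++ u.1)
    (hu' : w k = x ++ u'.1) :
    val x (p k) u' ≤ val x (p i) u ∧
      ((∃ n, i ≤ n ∧ n < k ∧ mark n) → val x (p k) u' < val x (p i) u) := by
  classical
  rcases hik.eq_or_lt with rfl | hlt
  · have : u = u' := Subtype.ext (List.append_cancel_left (hu.symm.trans hu'))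
    subst this
    exact ⟨le_rfl, fun ⟨n, h1, h2, _⟩ => by omega⟩
  by_cases hd : (w i).dropLast = x
  · obtain ⟨u₁, hu₁⟩ := hpush i
    have h1 := hstep i hi u u₁ (hd ▸ hu) hu₁
    rw [hd] at h1 hu₁
    have h2 := excursion hL hpush hshift hstep (i + 1) k x u₁ u' (by omega) hlt
      (fun n hn => hx n (by omega)) hu₁ hu'
    refine ⟨h2.1.trans h1.1, fun ⟨n, hn, hnk, hm⟩ => ?_⟩
    rcases hn.eq_or_lt with rfl | hn
    · exact h2.1.trans_lt (h1.2 hm)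
    · exact (h2.2 ⟨n, hn, hnk, hm⟩).trans_le h1.1
  · obtain ⟨z, hz⟩ := hx i le_rfl hlt
    obtain ⟨a, z, rfl⟩ : ∃ a z', z = a :: z' := by
      cases z with
      | nil => exact absurd (by simpa using hz.symm) hd
      | cons a z' => exact ⟨a, z', rfl⟩
    obtain ⟨s, hs⟩ := List.dropLast_prefix (w i)
    have hua : u.1 = a :: (z ++ s) := by
      refine List.append_cancel_left (as := x) ?_
      rw [← hu, ← hs, ← hz]
      simp
    have hex : ∃ n, i < n ∧ (n = k ∨ (w n).dropLast = x) := ⟨k, hlt, .inl rfl⟩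
    obtain ⟨i', ⟨hii', hend⟩, hmin⟩ : ∃ n, (i < n ∧ (n = k ∨ (w n).dropLast = x)) ∧
        ∀ n', n' < n → ¬ (i < n' ∧ (n' = k ∨ (w n').dropLast = x)) :=
      ⟨Nat.find hex, Nat.find_spec hex, fun n' => Nat.find_min hex⟩
    have hi'k : i' ≤ k := by
      by_contra! hcon
      exact hmin k hcon ⟨hlt, .inl rfl⟩
    have hinside : ∀ n, i ≤ n → n < i' → x ++ [a] <+: (w n).dropLast := by
      intro n hn
      induction n, hn using Nat.le_induction with
      | base => exact fun _ => ⟨z, by rw [← hz]; simp⟩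
      | succ n hn ih =>
        intro hni
        obtain ⟨v, hv⟩ := hpush n
        have h1 : x ++ [a] <+: w (n + 1) := hv ▸ (ih (by omega)).trans (List.prefix_append _ _)
        refine List.prefix_of_prefix_length_le h1 (List.dropLast_prefix _) ?_
        have h2 := hx (n + 1) (by omega) (by omega)
        have h3 : (w (n + 1)).dropLast ≠ x := fun h => hmin _ hni ⟨by omega, .inr h⟩
        have h4 := h2.length_le
        have h5 : x.length ≠ (w (n + 1)).dropLast.length := fun h => h3 (h2.eq_of_length h).symm
        simp only [List.length_append, List.length_singleton]
        omega
    obtain ⟨y, hy⟩ : x ++ [a] <+: w i' := by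
      obtain ⟨v, hv⟩ := hpush (i' - 1)
      rw [show i' - 1 + 1 = i' by omega] at hv
      exact hv ▸ (hinside (i' - 1) (by omega) (by omega)).trans (List.prefix_append _ _)
    have hylen : y.length + 1 ≤ L := by
      have hyl := congrArg List.length hy
      simp only [List.length_append, List.length_singleton] at hyl
      rcases hend with rfl | hend
      · rw [hu'] at hyl
        have := u'.2
        simp only [List.length_append] at hyl
        omega
      · have := congrArg List.length hend
        simp only [List.length_dropLast] at this
        omega
    have hlen := u.2
    rw [hua] at hlen
    simp only [List.length_cons] at hlen
    have h1 := excursion hL hpush hshift hstep i i' (x ++ [a]) ⟨z ++ s, by omega⟩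
      ⟨y, by omega⟩ hi hii'.le hinside (by rw [hu, hua]; simp) hy.symm
    have h2 := excursion hL hpush hshift hstep i' k x ⟨a :: y, hylen⟩ u' (by omega) hi'k
      (fun n hn => hx n (by omega)) (by rw [← hy]; simp) hu'
    have e1 := hshift x a (p i') (p i) ⟨a :: y, hylen⟩ u ⟨y, by omega⟩ ⟨z ++ s, by omega⟩ rfl hua
    have e2 := hshift x a (p i) (p i') u ⟨a :: y, hylen⟩ ⟨z ++ s, by omega⟩ ⟨y, by omega⟩ hua rfl
    rw [← e1, ← not_le, ← e2, not_le] at h1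
    refine ⟨h2.1.trans h1.1, fun ⟨n, hn, hnk, hm⟩ => ?_⟩
    rcases lt_or_ge n i' with hni | hni
    · exact h2.1.trans_lt (h1.2 ⟨n, hn, hni, hm⟩)
    · exact (h2.2 ⟨n, hni, hnk, hm⟩).trans_le h1.1
termination_by (k - i, u.1.length)
decreasing_by
  · exact Prod.Lex.left _ _ (by omega)
  · rcases hi'k.eq_or_lt with rfl | hlt'
    · exact Prod.Lex.right _ (by rw [hua]; simp)
    · exact Prod.Lex.left _ _ (by omega)
  · exact Prod.Lex.left _ _ (by omega)

/-- The node of the `A`-branching tree at depth `k` on the branch `b`. -/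
abbrev node (b : ℕ → A) (k : ℕ) : List A := List.ofFn fun i : Fin k => b i.val

theorem node_succ (b : ℕ → A) (k : ℕ) : node b (k + 1) = node b k ++ [b k] := by
  rw [node, List.ofFn_succ', List.concat_eq_append]
  rfl

/-- An infinite play marked infinitely often induces a descending thread of values along a branch
of the tree of stack contents. -/
theorem exists_thread (hL : 1 ≤ L)
    (hpush : ∀ n, ∃ u : Pend A L, w (n + 1) = (w n).dropLast ++ u.1)
    (hshift : ∀ x a p₁ p₂ (u₁ u₂ v₁ v₂ : Pend A L), u₁.1 = a :: v₁.1 → u₂.1 = a :: v₂.1 →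
      (val x p₁ u₁ ≤ val x p₂ u₂ ↔ val (x ++ [a]) p₁ v₁ ≤ val (x ++ [a]) p₂ v₂))
    (hstep : ∀ n, K ≤ n → ∀ u u' : Pend A L, w n = (w n).dropLast ++ u.1 →
      w (n + 1) = (w n).dropLast ++ u'.1 →
      val (w n).dropLast (p (n + 1)) u' ≤ val (w n).dropLast (p n) u ∧
        (mark n → val (w n).dropLast (p (n + 1)) u' < val (w n).dropLast (p n) u))
    (hmark : {n | mark n}.Infinite) :
    ∃ (b : ℕ → A) (k₀ : ℕ) (th : ℕ → P × Pend A L) (strict : ℕ → Prop),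
      {k | strict k}.Infinite ∧ ∀ k, ∃ v : Pend A L, (th k).2.1 = b (k₀ + k) :: v.1 ∧
        val (node b (k₀ + k + 1)) (th (k + 1)).1 (th (k + 1)).2 ≤
          val (node b (k₀ + k + 1)) (th k).1 v ∧
        (strict k → val (node b (k₀ + k + 1)) (th (k + 1)).1 (th (k + 1)).2 <
          val (node b (k₀ + k + 1)) (th k).1 v) := by
  classical
  have hprefix : ∀ n, (w n).dropLast <+: w (n + 1) := fun n => by
    obtain ⟨u, hu⟩ := hpush n
    exact hu ▸ List.prefix_append _ _
  by_cases hbdd : ∃ k, ∀ T, ∃ n, T ≤ n ∧ (w n).dropLast.length ≤ k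
  · exfalso
    obtain ⟨k, hk, T, hT⟩ : ∃ k, (∀ T, ∃ n, T ≤ n ∧ (w n).dropLast.length ≤ k) ∧
        ∃ T, ∀ n, T ≤ n → k ≤ (w n).dropLast.length := by
      refine ⟨Nat.find hbdd, Nat.find_spec hbdd, ?_⟩
      rcases hn : Nat.find hbdd with _ | k
      · exact ⟨0, by simp⟩
      · have := Nat.find_min hbdd (m := k) (by omega)
        push Not at this
        exact this
    obtain ⟨N, hN, hNk⟩ := hk (max T K)
    have hTN : T ≤ N := (le_max_left _ _).trans hN
    have hKN : K ≤ N := (le_max_right _ _).trans hN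
    set x := (w N).dropLast with hx
    have hxk : x.length = k := le_antisymm hNk (hT N hTN)
    have hxpre : ∀ n, N ≤ n → x <+: (w n).dropLast := by
      intro n hn
      induction n, hn using Nat.le_induction with
      | base => exact List.prefix_rfl
      | succ n hn ih =>
        exact List.prefix_of_prefix_length_le (ih.trans (hprefix n)) (List.dropLast_prefix _)
          (hxk ▸ hT (n + 1) (by omega))
    have hvisit : ∀ M, ∃ n, M ≤ n ∧ N ≤ n ∧ ∃ u : Pend A L, w n = x ++ u.1 := by
      intro M
      obtain ⟨n, hn, hnk⟩ := hk (max M N)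
      have hNn : N ≤ n := (le_max_right _ _).trans hn
      obtain ⟨z, hz⟩ := (hxpre n hNn).trans (List.dropLast_prefix _)
      refine ⟨n, (le_max_left _ _).trans hn, hNn, ⟨z, ?_⟩, hz.symm⟩
      have h1 := congrArg List.length hz
      simp only [List.length_append] at h1
      simp only [List.length_dropLast] at hnk
      omega
    have hdesc : ∀ o : Ordinal.{0}, ∀ n (u : Pend A L), N ≤ n → w n = x ++ u.1 →
        val x (p n) u = o → False := by
      intro o
      induction o using WellFoundedLT.induction with
      | _ o ih =>
        intro n u hn hu ho
        obtain ⟨n₁, hn₁, hm⟩ := exists_gt_of_infinite hmark n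
        obtain ⟨n₂, hn₂, -, u₂, hu₂⟩ := hvisit (n₁ + 1)
        have := (excursion hL hpush hshift hstep n n₂ x u u₂ (by omega) (by omega)
          (fun i hi _ => hxpre i (by omega)) hu hu₂).2 ⟨n₁, hn₁.le, by omega, hm⟩
        exact ih _ (ho ▸ this) n₂ u₂ (by omega) hu₂ rfl
    obtain ⟨n, -, hn, u, hu⟩ := hvisit 0
    exact hdesc _ n u hn hu rfl
  · push Not at hbdd
    have hex : ∀ k, ∃ T, K ≤ T ∧ ∀ n, T ≤ n → k < (w n).dropLast.length := fun k => by
      obtain ⟨T, hT⟩ := hbdd k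
      exact ⟨max T K, le_max_right _ _, fun n hn => hT n ((le_max_left _ _).trans hn)⟩
    obtain ⟨T, hTK, hT, hTmin⟩ : ∃ T : ℕ → ℕ, (∀ k, K ≤ T k) ∧
        (∀ k n, T k ≤ n → k < (w n).dropLast.length) ∧
        ∀ k T', K ≤ T' → (∀ n, T' ≤ n → k < (w n).dropLast.length) → T k ≤ T' :=
      ⟨fun k => Nat.find (hex k), fun k => (Nat.find_spec (hex k)).1,
        fun k => (Nat.find_spec (hex k)).2, fun k T' h1 h2 => Nat.find_min' (hex k) ⟨h1, h2⟩⟩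
    have hTmono : Monotone T := monotone_nat_of_le_succ fun k =>
      hTmin k _ (hTK _) fun n hn => (Nat.lt_succ_self k).trans (hT (k + 1) n hn)
    have hTunb : ∀ M, ∃ k, M < T k := fun M =>
      ⟨(w M).dropLast.length, by
        by_contra! hcon
        exact lt_irrefl _ (hT _ M hcon)⟩
    have hTlast : ∀ k, (w K).dropLast.length ≤ k →
        K < T k ∧ (w (T k - 1)).dropLast.length ≤ k := by
      intro k hk
      have h1 : K < T k := lt_of_le_of_ne (hTK k) fun h => by
        have := hT k K h.ge
        omega
      refine ⟨h1, ?_⟩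
      by_contra! hcon
      have := hTmin k (T k - 1) (by omega) fun n hn => by
        rcases hn.eq_or_lt with rfl | hn
        · exact hcon
        · exact hT k n (by omega)
      omega
    have hget : ∀ k n, T k ≤ n → (w n)[k]? = (w (T k))[k]? := by
      intro k n hn
      induction n, hn using Nat.le_induction with
      | base => rfl
      | succ n hn ih =>
        rw [← ih]
        obtain ⟨s, hs⟩ := hprefix n
        obtain ⟨s', hs'⟩ := List.dropLast_prefix (w n)
        have := hT k n hn
        rw [← hs, List.getElem?_append_left this]
        conv_rhs => rw [← hs', List.getElem?_append_left this]
    have hb : ∀ k, ∃ a, (w (T k))[k]? = some a := by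
      intro k
      have := hT k (T k) le_rfl
      simp only [List.length_dropLast] at this
      exact ⟨_, List.getElem?_eq_getElem (by omega)⟩
    choose b hb using hb
    have hnode : ∀ k n, T k ≤ n → w n = node b k ++ (w n).drop k ∧
        w n = node b (k + 1) ++ (w n).drop (k + 1) := by
      have hpre : ∀ l n, (∀ i, i < l → T i ≤ n) → node b l = (w n).take l := by
        intro l n hl
        refine List.ext_getElem? fun i => ?_
        by_cases hi : i < l
        · rw [List.getElem?_take_of_lt hi, hget i n (hl i hi), hb,
            List.getElem?_eq_getElem (by simpa using hi)]
          simp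
        · rw [List.getElem?_eq_none (by simpa using hi),
            List.getElem?_eq_none (by simp; omega)]
      intro k n hn
      refine ⟨?_, ?_⟩
      · rw [hpre k n fun i hi => (hTmono hi.le).trans hn, List.take_append_drop]
      · rw [hpre (k + 1) n fun i hi => (hTmono (Nat.lt_succ_iff.1 hi)).trans hn,
          List.take_append_drop]
    set k₀ := (w K).dropLast.length with hk₀
    have hlen : ∀ k, k₀ ≤ k → ((w (T k)).drop k).length ≤ L := by
      intro k hk
      obtain ⟨h1, h2⟩ := hTlast k hk
      obtain ⟨u, hu⟩ := hpush (T k - 1)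
      rw [show T k - 1 + 1 = T k by omega] at hu
      have h3 := u.2
      rw [List.length_drop, hu, List.length_append]
      omega
    refine ⟨b, k₀, fun i => (p (T (k₀ + i)), ⟨_, hlen (k₀ + i) (by omega)⟩),
      fun i => ∃ n, T (k₀ + i) ≤ n ∧ n < T (k₀ + i + 1) ∧ mark n,
      infinite_of_exists_ge fun M => ?_, fun i => ?_⟩
    · obtain ⟨n, hn, hm⟩ := exists_gt_of_infinite hmark (T (k₀ + M))
      have hex' := hTunb n
      have hspec := Nat.find_spec hex'
      have hgt : k₀ + M < Nat.find hex' := by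
        by_contra! hcon
        have := hTmono hcon
        omega
      refine ⟨Nat.find hex' - 1 - k₀, by omega, n, ?_, ?_, hm⟩
      · rw [show k₀ + (Nat.find hex' - 1 - k₀) = Nat.find hex' - 1 by omega]
        exact not_lt.1 (Nat.find_min hex' (m := Nat.find hex' - 1) (by omega))
      · rwa [show k₀ + (Nat.find hex' - 1 - k₀) + 1 = Nat.find hex' by omega]
    · have h1 := hnode (k₀ + i) (T (k₀ + i)) le_rfl
      have h2 := hnode (k₀ + i + 1) (T (k₀ + i + 1)) le_rfl
      have hl := hlen (k₀ + i) (by omega)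
      have hcons : (w (T (k₀ + i))).drop (k₀ + i) =
          b (k₀ + i) :: (w (T (k₀ + i))).drop (k₀ + i + 1) := by
        refine List.append_cancel_left (as := node b (k₀ + i)) ?_
        rw [← h1.1]
        conv_lhs => rw [h1.2, node_succ]
        simp
      rw [hcons, List.length_cons] at hl
      refine ⟨⟨(w (T (k₀ + i))).drop (k₀ + i + 1), by omega⟩, hcons, ?_⟩
      exact excursion hL hpush hshift hstep (T (k₀ + i)) (T (k₀ + i + 1)) (node b (k₀ + i + 1))
        _ ⟨_, hlen (k₀ + (i + 1)) (by omega)⟩ (hTK _) (hTmono (Nat.le_succ _))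
        (fun n hn _ => List.prefix_of_prefix_length_le
          ⟨_, (hnode (k₀ + i) n hn).2.symm⟩ (List.dropLast_prefix _)
          (by rw [List.length_ofFn]; exact hT _ n hn)) h1.2 h2.1

end Thread

theorem ruleStep_iff {r : PDRule A P} {v v' : List A × P} :
    RuleStep r v v' ↔
      r.src = v.2 ∧ r.pop = v.1.getLast? ∧ v' = (v.1.dropLast ++ r.push, r.dst) := by
  obtain ⟨w, p⟩ := v
  obtain ⟨w', p'⟩ := v'
  rcases List.eq_nil_or_concat w with rfl | ⟨x, a, rfl⟩
  · constructor
    · rintro ⟨h1, h2, ⟨_, _, -, h, -⟩ | ⟨h3, -, h4⟩⟩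
      · simp at h
      · exact ⟨h1, h3, Prod.ext h4 h2.symm⟩
    · rintro ⟨h1, h2, h3⟩
      obtain ⟨h3, h4⟩ := Prod.mk.inj h3
      exact ⟨h1, h4.symm, .inr ⟨h2, rfl, h3⟩⟩
  · simp only [RuleStep, List.concat_eq_append, List.getLast?_append, List.getLast?_singleton,
      Option.some_or, List.dropLast_concat, Prod.mk.injEq]
    constructor
    · rintro ⟨h1, h2, ⟨y, b, h3, h4, h5⟩ | ⟨-, h4, -⟩⟩
      · obtain ⟨rfl, hb⟩ := List.append_inj' h4 rfl
        simp only [List.cons.injEq, and_true] at hb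
        exact ⟨h1, hb ▸ h3, h5, h2.symm⟩
      · simp at h4
    · rintro ⟨h1, h2, h3, h4⟩
      exact ⟨h1, h4.symm, .inl ⟨x, a, h2, rfl, h3⟩⟩

theorem exists_tree {S : Type} {Inv : List A → S → Prop} {Step : List A → S → A → S → Prop}
    (h₀ : ∃ s, Inv [] s)
    (hs : ∀ w s a, Inv w s → ∃ s', Inv (w ++ [a]) s' ∧ Step w s a s') :
    ∃ f : List A → S, (∀ w, Inv w (f w)) ∧ ∀ w a, Step w (f w) a (f (w ++ [a])) := by
  obtain ⟨s₀, h₀⟩ := h₀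
  have : Nonempty S := ⟨s₀⟩
  choose! next h1 h2 using hs
  let F : List A → List A × S := fun w =>
    w.foldl (fun x a => (x.1 ++ [a], next x.1 x.2 a)) ([], s₀)
  have hF : ∀ w a, F (w ++ [a]) = ((F w).1 ++ [a], next (F w).1 (F w).2 a) := fun w a => by
    simp only [F, List.foldl_append, List.foldl_cons, List.foldl_nil]
  have hfst : ∀ w, (F w).1 = w := by
    intro w
    induction w using List.reverseRecOn with
    | nil => rfl
    | append_singleton w a ih => rw [hF, ih]
  have hsnd : ∀ w a, (F (w ++ [a])).2 = next w (F w).2 a := fun w a => by rw [hF, hfst]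
  have hinv : ∀ w, Inv w (F w).2 := by
    intro w
    induction w using List.reverseRecOn with
    | nil => exact h₀
    | append_singleton w a ih => rw [hsnd]; exact h1 w _ a ih
  exact ⟨fun w => (F w).2, hinv, fun w a => by
    dsimp only
    rw [hsnd]
    exact h2 w _ a (hinv w)⟩

theorem exists_path_of_reflTransGen {V : Type} {R : V → V → Prop} {v₀ : V} {π : ℕ → V}
    (h : Relation.ReflTransGen R v₀ (π 0)) (hπ : ∀ n, R (π n) (π (n + 1))) :
    ∃ (π' : ℕ → V) (k : ℕ), π' 0 = v₀ ∧ (∀ n, R (π' n) (π' (n + 1))) ∧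
      ∀ n, π' (k + n) = π n := by
  induction h using Relation.ReflTransGen.head_induction_on with
  | refl => exact ⟨π, 0, rfl, hπ, fun n => by rw [Nat.zero_add]⟩
  | @head u v huv _ ih =>
    obtain ⟨π', k, h0, h1, h2⟩ := ih
    refine ⟨fun n => Nat.casesOn n u π', k + 1, rfl, fun n => ?_, fun n => ?_⟩
    · cases n with
      | zero =>
        rw [← h0] at huv
        exact huv
      | succ n => exact h1 n
    · rw [Nat.add_right_comm]
      exact h2 n

/-- The empty stack content. -/
def Pend.nil {L : ℕ} : Pend A L := ⟨[], Nat.zero_le _⟩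

/-- The indices of the values annotating a node `w`: the index `(p, u, j)` stands for the vertex
`(w ++ u, p)` and the odd color `2 * j + 1`. -/
abbrev Index (A P : Type) (L D : ℕ) : Type := P × Pend A L × Fin D

/-- The states of the automaton. Besides the instruction, a state records which vertices
`(w ++ u, p)` are reached, the order of the values, and an appearance record. -/
structure Ann (pOwner : P → Player) (Δ : Finset (PDRule A P)) (L D N : ℕ) where
  label : Instr pOwner Δ
  reach : P → Pend A L → Prop
  le : Index A P L D → Index A P L D → Prop
  age : Index A P L D → Fin N
  prio : Fin (2 * N + 1)

instance [Finite A] {L : ℕ} : Finite (Pend A L) := List.finite_length_le A L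

instance [Finite A] [Finite P] {pOwner : P → Player} {Δ : Finset (PDRule A P)} {L D N : ℕ} :
    Finite (Ann pOwner Δ L D N) :=
  Finite.of_injective (fun s => (s.label, s.reach, s.le, s.age, s.prio)) fun s s' h => by
    cases s
    cases s'
    simpa using h

/-- The values `ρ` are ordered by `le`. -/
def Induces {Q : Type} (ρ : Q → Ordinal.{0}) (le : Q → Q → Prop) : Prop :=
  ∀ q q', le q q' ↔ ρ q ≤ ρ q'

section Automaton

variable {pOwner : P → Player} {Δ : Finset (PDRule A P)} {L D N : ℕ}

/-- The annotations of a node and of its child in direction `a` agree on common vertices. -/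
def Shift (a : A) (reach reach' : P → Pend A L → Prop)
    (ρ ρ' : Index A P L D → Ordinal.{0}) : Prop :=
  ∀ p (u v : Pend A L), u.1 = a :: v.1 →
    (reach p u → reach' p v) ∧ ∀ j, ρ (p, u, j) = ρ' (p, v, j)

/-- The moves under the instruction `ι` at a reached vertex with top symbol `top` are legal and
respect the annotations, given by `reach'` and `ρ'` at that vertex and by `reach` and `ρ` below
the top symbol. -/
def Follows (c : P → ℕ) (ι : Instr pOwner Δ) (top : Option A) (reach reach' : P → Pend A L → Prop)
    (ρ ρ' : Index A P L D → Ordinal.{0}) : Prop :=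
  ∀ p, reach' p .nil →
    (∀ h : pOwner p = Player.two, (ι ⟨p, h⟩).val.src = p ∧ (ι ⟨p, h⟩).val.pop = top) ∧
    ∀ (r : PDRule A P) (u : Pend A L), Allowed ι p r → r.src = p → r.pop = top → u.1 = r.push →
      reach r.dst u ∧ ∀ j : Fin D, c p ≤ 2 * j + 1 →
        ρ (r.dst, u, j) ≤ ρ' (p, .nil, j) ∧ (c p = 2 * j + 1 → ρ (r.dst, u, j) < ρ' (p, .nil, j))

/-- The condition on the state at the root. -/
def IsRoot (c : P → ℕ) (v₀ : List A × P) (s : Ann pOwner Δ L D N) : Prop :=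
  (∀ u : Pend A L, u.1 = v₀.1 → s.reach v₀.2 u) ∧
    ∃ ρ, Induces ρ s.le ∧ Follows c s.label none s.reach s.reach ρ ρ

/-- The condition on the states at a node and at its child in direction `a`, witnessed by
values `ρ` and `ρ'`. -/
structure IsEdge (c : P → ℕ) (a : A) (s s' : Ann pOwner Δ L D N)
    (ρ ρ' : Index A P L D → Ordinal.{0}) : Prop where
  induces : Induces ρ s.le
  induces' : Induces ρ' s'.le
  ageOf : AgeOf ρ fun q => s.age q
  ageOf' : AgeOf ρ' fun q => s'.age q
  step : RecordStep N ρ (fun q => s.age q) ρ' (fun q => s'.age q) s'.prio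
  shift : Shift a s.reach s'.reach ρ ρ'
  follows : Follows c s'.label (some a) s.reach s'.reach ρ ρ'

/-- The transition relation of the automaton. -/
def transitions (c : P → ℕ) :
    Set (Ann pOwner Δ L D N × Instr pOwner Δ × (A → Ann pOwner Δ L D N)) :=
  {x | x.1.label = x.2.1 ∧ (∃ ρ, Induces ρ x.1.le) ∧ ∀ a, ∃ ρ ρ', IsEdge c a x.1 (x.2.2 a) ρ ρ'}

variable {c : P → ℕ} {t : List A → Instr pOwner Δ} {v₀ : List A × P}

theorem exists_rank_of_good (h : Good c t v₀) (j : ℕ) :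
    ∃ ρ : List A × P → Ordinal.{0}, ∀ v v', Relation.ReflTransGen (Move t) v₀ v → Move t v v' →
      c v.2 ≤ 2 * j + 1 → ρ v' ≤ ρ v ∧ (c v.2 = 2 * j + 1 → ρ v' < ρ v) := by
  obtain ⟨ρ, hρ⟩ := exists_rank
    (fun v v' => Relation.ReflTransGen (Move t) v₀ v ∧ Move t v v' ∧ c v.2 ≤ 2 * j + 1)
    (fun v => c v.2 = 2 * j + 1) (by
      intro π hπ hinf
      obtain ⟨π', k, h0, h1, h2⟩ := exists_path_of_reflTransGen (hπ 0).1 fun n => (hπ n).2.1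
      have hmax := h.2 π' h0 h1
      rw [maxInfEven_iff_even (m := 2 * j + 1) (K := k)] at hmax
      · simp at hmax
      · refine infinite_of_exists_ge fun K => ?_
        obtain ⟨n, hn, hc⟩ := exists_gt_of_infinite hinf K
        exact ⟨k + n, by omega, by rw [h2]; exact hc⟩
      · intro n hn
        obtain ⟨n, rfl⟩ := Nat.exists_eq_add_of_le hn
        rw [h2]
        exact (hπ n).2.2)
  exact ⟨ρ, fun v v' h1 h2 h3 => hρ v v' ⟨h1, h2, h3⟩⟩

/-- A tree determining a winning strategy has an accepting run. -/
theorem exists_run [Fintype (Index A P L D)] (hN : N = Fintype.card (Index A P L D))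
    (h : Good c t v₀) :
    ∃ R : List A → Ann pOwner Δ L D N, IsRoot c v₀ (R []) ∧
      (∀ w, (R w, t w, fun a => R (w ++ [a])) ∈ transitions c) ∧
      ∀ b : ℕ → A, MaxInfEven fun k => (R (node b k)).prio := by
  choose ρ hρ using exists_rank_of_good h
  let val : List A → Index A P L D → Ordinal.{0} := fun w q => ρ q.2.2 (w ++ q.2.1.1, q.1)
  let reach : List A → P → Pend A L → Prop := fun w p u =>
    Relation.ReflTransGen (Move t) v₀ (w ++ u.1, p)
  obtain ⟨f, hinv, hstep⟩ := exists_tree (A := A) (S := (Index A P L D → ℕ) × ℕ)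
    (Inv := fun w s => Ranked N (val w) s.1 ∧ s.2 ≤ 2 * N)
    (Step := fun w s a s' => RecordStep N (val w) s.1 (val (w ++ [a])) s'.1 s'.2 ∧
      (¬ Even s'.2 → ∃ q q', s.1 q = N - (s'.2 + 1) / 2 ∧ s'.1 q' = s.1 q ∧
        val (w ++ [a]) q' < val w q))
    (by
      obtain ⟨age, hage⟩ := exists_ranked (val [])
      exact ⟨(age, 0), hN ▸ hage, Nat.zero_le _⟩)
    (by
      subst hN
      rintro w s a ⟨hs, -⟩
      obtain ⟨age, κ, h1, h2, h3, h4⟩ := hs.exists_step (val (w ++ [a]))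
      exact ⟨(age, κ), ⟨h1, h2⟩, h3, h4⟩)
  have hfollows : ∀ w, Follows c (t w) w.getLast? (reach w.dropLast) (reach w) (val w.dropLast)
      (val w) := by
    intro w p hp
    have hp' : Relation.ReflTransGen (Move t) v₀ (w, p) := by
      simpa only [reach, Pend.nil, List.append_nil] using hp
    refine ⟨fun ho => ?_, fun r u hr hsrc hpop hu => ?_⟩
    · obtain ⟨v', r, hr, hs⟩ := h.1 _ hp'
      rw [hr.2 ho]
      rw [ruleStep_iff] at hs
      exact ⟨hs.1, hs.2.1⟩
    · have hm : Move t (w, p) (w.dropLast ++ u.1, r.dst) :=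
        ⟨r, hr, ruleStep_iff.2 ⟨hsrc, hpop, by rw [hu]⟩⟩
      refine ⟨hp'.tail hm, fun j hj => ?_⟩
      simpa only [val, Pend.nil, List.append_nil] using hρ j _ _ hp' hm hj
  refine ⟨fun w => ⟨t w, reach w, fun q q' => val w q ≤ val w q',
    fun q => ⟨(f w).1 q, (hinv w).1.lt q⟩, ⟨(f w).2, Nat.lt_succ_of_le (hinv w).2⟩⟩,
    ⟨fun u hu => ?_, val [], fun _ _ => Iff.rfl, hfollows []⟩, fun w => ⟨rfl,
    ⟨val w, fun _ _ => Iff.rfl⟩, fun a => ⟨val w, val (w ++ [a]), fun _ _ => Iff.rfl,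
    fun _ _ => Iff.rfl, (hinv w).1.ageOf, (hinv (w ++ [a])).1.ageOf, (hstep w a).1,
    fun p u v huv => ⟨fun hr => ?_, fun j => ?_⟩, ?_⟩⟩, fun b => ?_⟩
  · simpa only [reach, hu, List.nil_append] using Relation.ReflTransGen.refl
  · simpa only [reach, huv, List.append_assoc, List.singleton_append] using hr
  · simp only [val, huv, List.append_assoc, List.singleton_append]
  · simpa only [List.getLast?_append, List.getLast?_singleton, Option.some_or,
      List.dropLast_concat] using hfollows (w ++ [a])
  · refine maxInfEven_of_records (N := N) (ρ := fun k => val (node b k))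
      (age := fun k => (f (node b k)).1) (fun k => (hinv _).2) (fun k => (hinv _).1.ageOf)
      (fun k => ?_) (fun k => ?_)
    · simpa only [node_succ] using (hstep (node b k) (b k)).1
    · simpa only [node_succ] using (hstep (node b k) (b k)).2

/-- The moves at `(w, p)` respect the annotations given by the states of a run. -/
theorem step_of_run (hpush : ∀ r ∈ Δ, r.push.length ≤ L)
    {R : List A → Ann pOwner Δ L D N} (hroot : IsRoot c v₀ (R []))
    (hR : ∀ w, (R w, t w, fun a => R (w ++ [a])) ∈ transitions c) {w : List A} {p : P}
    (hp : (R w).reach p .nil) :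
    (∀ h : pOwner p = Player.two, ∃ v', RuleStep (t w ⟨p, h⟩).val (w, p) v') ∧
    ∀ v', Move t (w, p) v' → ∃ u' : Pend A L, v'.1 = w.dropLast ++ u'.1 ∧
      (R w.dropLast).reach v'.2 u' ∧
      ∀ ρ, Induces ρ (R w.dropLast).le → ∀ u : Pend A L, w = w.dropLast ++ u.1 →
        ∀ j : Fin D, c p ≤ 2 * j + 1 → ρ (v'.2, u', j) ≤ ρ (p, u, j) ∧
          (c p = 2 * j + 1 → ρ (v'.2, u', j) < ρ (p, u, j)) := by
  obtain ⟨ρ, ρ', hρ, hF, hsh⟩ : ∃ ρ ρ', Induces ρ (R w.dropLast).le ∧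
      Follows c (t w) w.getLast? (R w.dropLast).reach (R w).reach ρ ρ' ∧
      ∀ u : Pend A L, w = w.dropLast ++ u.1 → ∀ j, ρ (p, u, j) = ρ' (p, .nil, j) := by
    rcases List.eq_nil_or_concat w with rfl | ⟨x, a, rfl⟩
    · obtain ⟨-, ρ, h1, h2⟩ := hroot
      rw [(hR []).1] at h2
      refine ⟨ρ, ρ, h1, h2, fun u hu j => ?_⟩
      rw [show u = .nil from Subtype.ext hu.symm]
    · rw [List.concat_eq_append]
      obtain ⟨ρ, ρ', he⟩ := (hR x).2.2 a
      have hf := he.follows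
      rw [show (R (x ++ [a])).label = _ from (hR (x ++ [a])).1] at hf
      refine ⟨ρ, ρ', ?_, ?_, fun u hu j => ?_⟩
      · simpa only [List.dropLast_concat] using he.induces
      · simpa only [List.getLast?_append, List.getLast?_singleton, Option.some_or,
          List.dropLast_concat] using hf
      · rw [List.dropLast_concat] at hu
        exact (he.shift p u .nil (List.append_cancel_left hu).symm).2 j
  obtain ⟨hlegal, hdesc⟩ := hF p hp
  refine ⟨fun ho => ⟨_, ruleStep_iff.2 ⟨(hlegal ho).1, (hlegal ho).2, rfl⟩⟩, ?_⟩
  rintro v' ⟨r, hr, hs⟩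
  obtain ⟨hsrc, hpop, rfl⟩ := ruleStep_iff.1 hs
  obtain ⟨h1, h2⟩ := hdesc r ⟨r.push, hpush r hr.1⟩ hr hsrc hpop rfl
  refine ⟨⟨r.push, hpush r hr.1⟩, rfl, h1, fun σ hσ u hu j hj => ?_⟩
  rw [← hσ, hρ, ← not_le (a := σ _), ← hσ, hρ, not_le, hsh u hu]
  exact h2 j hj

/-- A tree with an accepting run determines a winning strategy. -/
theorem good_of_run (hL : 1 ≤ L) (hpush : ∀ r ∈ Δ, r.push.length ≤ L) (hv₀ : v₀.1.length ≤ L)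
    (hD : ∀ p, c p < D) (htot : ∀ v, ∃ w, (pushdownGame pOwner Δ c).E v w)
    {R : List A → Ann pOwner Δ L D N} (hroot : IsRoot c v₀ (R []))
    (hR : ∀ w, (R w, t w, fun a => R (w ++ [a])) ∈ transitions c)
    (hacc : ∀ b : ℕ → A, MaxInfEven fun k => (R (node b k)).prio) : Good c t v₀ := by
  have hdown : ∀ (u : List A) (hu : u.length ≤ L) w p, (R w).reach p ⟨u, hu⟩ →
      (R (w ++ u)).reach p .nil := by
    intro u
    induction u with
    | nil => intro _ w p h; rwa [List.append_nil]
    | cons a u ih =>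
      intro hu w p h
      obtain ⟨ρ, ρ', he⟩ := (hR w).2.2 a
      have := ih (by simp only [List.length_cons] at hu; omega) (w ++ [a]) p
        ((he.shift p _ _ rfl).1 h)
      rwa [List.append_assoc] at this
  have hreach : ∀ v, Relation.ReflTransGen (Move t) v₀ v → (R v.1).reach v.2 .nil := by
    intro v hv
    induction hv with
    | refl => exact hdown v₀.1 hv₀ [] _ (hroot.1 _ rfl)
    | @tail v v' _ hm ih =>
      obtain ⟨u', h1, h2, -⟩ := (step_of_run hpush hroot hR ih).2 v' hm
      rw [h1]
      exact hdown u'.1 u'.2 _ _ h2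
  refine ⟨fun v hv => ?_, fun π hπ0 hπ => ?_⟩
  · by_cases ho : pOwner v.2 = Player.two
    · obtain ⟨v', hv'⟩ := (step_of_run hpush hroot hR (hreach v hv)).1 ho
      exact ⟨v', _, ⟨(t v.1 ⟨v.2, ho⟩).2, fun _ => rfl⟩, hv'⟩
    · obtain ⟨v', r, hr, hs⟩ := htot v
      exact ⟨v', r, ⟨hr, fun h => absurd h ho⟩, hs⟩
  obtain ⟨m, hmi, K, hK⟩ := exists_eventual_max fun k => (hD (π k).2).le
  rw [maxInfEven_iff_even hmi hK]
  by_contra hodd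
  obtain ⟨i, rfl⟩ := Nat.not_even_iff_odd.1 hodd
  obtain ⟨n₀, -, hn₀⟩ := exists_gt_of_infinite hmi 0
  let j : Fin D := ⟨i, by have := hD (π n₀).2; omega⟩
  choose val hval using fun w => (hR w).2.1
  have hplay : ∀ n, Relation.ReflTransGen (Move t) v₀ (π n) := by
    intro n
    induction n with
    | zero => rw [hπ0]
    | succ n ih => exact ih.tail (hπ n)
  have hst := fun n => (step_of_run hpush hroot hR (hreach _ (hplay n))).2 _ (hπ n)
  obtain ⟨b, k₀, th, strict, hstrict, hth⟩ := exists_thread (L := L) (K := K)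
    (w := fun n => (π n).1) (p := fun n => (π n).2) (mark := fun n => c (π n).2 = 2 * i + 1)
    (val := fun x p u => val x (p, u, j)) hL (fun n => (hst n).imp fun _ h => h.1)
    (by
      intro x a p₁ p₂ u₁ u₂ v₁ v₂ h1 h2
      obtain ⟨ρ, ρ', he⟩ := (hR x).2.2 a
      rw [← hval x, ← hval (x ++ [a]), he.induces, he.induces', (he.shift _ _ _ h1).2,
        (he.shift _ _ _ h2).2])
    (by
      intro n hn u u' hu hu'
      obtain ⟨u'', h1, -, h2⟩ := hst n
      obtain rfl : u' = u'' := Subtype.ext (List.append_cancel_left (hu'.symm.trans h1))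
      exact h2 _ (hval _) u hu j (hK n hn))
    hmi
  have hκ : MaxInfEven fun k => ((R (node b (k₀ + k))).prio : ℕ) := by
    obtain ⟨m, h1, K, h2⟩ := exists_eventual_max fun k => ((R (node b k)).prio).is_le
    have heven := (maxInfEven_iff_even h1 h2).1 (hacc b)
    rw [maxInfEven_iff_even (m := m) (K := K)]
    · exact heven
    · refine infinite_of_exists_ge fun M => ?_
      obtain ⟨k, hk, hm⟩ := exists_gt_of_infinite h1 (k₀ + M)
      exact ⟨k - k₀, by omega, by rwa [show k₀ + (k - k₀) = k by omega]⟩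
    · exact fun k hk => h2 _ (by omega)
  refine no_descending_thread (N := N) (le := fun k => (R (node b (k₀ + k))).le)
    (age := fun k q => (R (node b (k₀ + k))).age q) (th := fun k => ((th k).1, (th k).2, j))
    (fun k => ((R (node b (k₀ + k))).prio).is_le) hκ hstrict fun k => ?_
  obtain ⟨v, hv, h1, h2⟩ := hth k
  obtain ⟨ρ, ρ', he⟩ := (hR (node b (k₀ + k))).2.2 (b (k₀ + k))
  dsimp only at he
  rw [← node_succ] at he
  refine ⟨ρ, ρ', he.induces, he.induces', he.ageOf, he.ageOf', he.step, ?_⟩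
  rw [(he.shift _ _ v hv).2, ← he.induces', ← not_le (a := ρ' _), ← he.induces', hval, hval, not_le]
  exact ⟨h1, h2⟩

end Automaton

end PushdownParity

/-- The set of instruction trees that determine memoryless winning strategies for
Player II from `v₀` in a pushdown parity game is recognizable by a nondeterministic
parity tree automaton. -/
theorem statement7 {A P : Type} [Finite A] [Finite P]
    (pOwner : P → Player) (Δ : Finset (PDRule A P)) (c : P → ℕ)
    (htot : ∀ v, ∃ w, (pushdownGame pOwner Δ c).E v w)
    (v₀ : List A × P) :
    ∃ (n : ℕ) (s0 : Fin n)
      (ΔB : Set (Fin n × ({p : P // pOwner p = Player.two} → {r : PDRule A P // r ∈ Δ}) ×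
        (A → Fin n)))
      (col : Fin n → ℕ),
      ∀ t : List A → ({p : P // pOwner p = Player.two} → {r : PDRule A P // r ∈ Δ}),
        NPTAAccepts s0 ΔB col t ↔
          ∃ f : List A × P → List A × P,
            MemorylessWinningFrom (pushdownGame pOwner Δ c) Player.two f v₀ ∧
            Determines pOwner Δ c Player.two t f v₀ := by
  classical
  have := Fintype.ofFinite A
  have := Fintype.ofFinite P
  obtain ⟨D, hD⟩ : ∃ D, ∀ p, c p < D :=
    ⟨Finset.univ.sup c + 1, fun p => Nat.lt_succ_of_le (Finset.le_sup (Finset.mem_univ p))⟩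
  let L := max 1 (max v₀.1.length (Δ.sup fun r => r.push.length))
  have hpush : ∀ r ∈ Δ, r.push.length ≤ L := fun r hr =>
    (Finset.le_sup (f := fun r : PDRule A P => r.push.length) hr).trans
      ((le_max_right _ _).trans (le_max_right _ _))
  have hv₀ : v₀.1.length ≤ L := (le_max_left _ _).trans (le_max_right _ _)
  have := Fintype.ofFinite (PushdownParity.Index A P L D)
  obtain ⟨n, s0, ΔB, col, h⟩ := PushdownParity.exists_npta (PushdownParity.IsRoot c v₀)
    (PushdownParity.transitions (pOwner := pOwner) (Δ := Δ)
      (N := Fintype.card (PushdownParity.Index A P L D)) c) fun s => s.prio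
  refine ⟨n, s0, ΔB, col, fun t => (h t).trans
    (Iff.trans ⟨?_, fun hg => ?_⟩ (PushdownParity.good_iff htot t v₀))⟩
  · rintro ⟨R, hroot, hR, hacc⟩
    exact PushdownParity.good_of_run (le_max_left _ _) hpush hv₀ hD htot hroot hR hacc
  · exact PushdownParity.exists_run rfl hg
end

section
/- Let G be a normal prefix-recognizable parity game graph over a finite stack alphabet 𝔸 and disjoint finite control-state sets Q_I, Q_II, and let 𝔹 = 𝔸 ∪ Q_I ∪ Q_II. Then the winning region of Player II in the parity game over G is a regular language over 𝔹, and likewise the winning region of Player I is a regular language over 𝔹. -/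
/-- A language of finite words over `B` is regular if it is recognized by a
deterministic finite automaton. -/
def RegularLang {B : Type} (L : Set (List B)) : Prop :=
  ∃ (n : ℕ) (s0 : Fin n) (δ : Fin n → B → Fin n) (F : Set (Fin n)),
    ∀ w, w ∈ L ↔ w.foldl δ s0 ∈ F

/-- A relation on finite words over `B` is prefix-recognizable if it is a finite union
of relations `{(w u, w v) | w ∈ W i, u ∈ U i, v ∈ V i}` with regular `U i, V i, W i`. -/
def PrefixRecognizable {B : Type} (R : List B → List B → Prop) : Prop :=
  ∃ (k : ℕ) (U V W : Fin k → Set (List B)),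
    (∀ i, RegularLang (U i) ∧ RegularLang (V i) ∧ RegularLang (W i)) ∧
    ∀ w₁ w₂, R w₁ w₂ ↔ ∃ i, ∃ w ∈ W i, ∃ u ∈ U i, ∃ v ∈ V i, w₁ = w ++ u ∧ w₂ = w ++ v

/-- Encoding of a vertex (stack content `w ∈ A*`, control state `q`) as the word `w q`
over the alphabet `A ⊕ Q`. -/
def encode {A Q : Type} (v : List A × Q) : List (A ⊕ Q) :=
  v.1.map Sum.inl ++ [Sum.inr v.2]

/-- A relation on vertices, viewed as a relation on their encodings. -/
def encRel {A Q : Type} (R : (List A × Q) → (List A × Q) → Prop) :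
    List (A ⊕ Q) → List (A ⊕ Q) → Prop :=
  fun w₁ w₂ => ∃ u v, w₁ = encode u ∧ w₂ = encode v ∧ R u v

/-- A normal prefix-recognizable parity game graph over the stack alphabet `A` and
control states `Q`: the vertices are pairs (stack content, control state), the owner and
the color of a vertex depend only on its control state. (The edge relation is required
to be prefix-recognizable on encodings via a separate hypothesis.) -/
def normalGame {A Q : Type} (qOwner : Q → Player) (qcol : Q → ℕ)
    (E : (List A × Q) → (List A × Q) → Prop) : GameGraph (List A × Q) :=
  ⟨fun v => qOwner v.2, E, fun v => qcol v.2⟩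

/-- A generalized strategy of player `p` with memory: in every memory state `m`, situated at the
vertex `pos m`, the player can proceed along `N` as owner, respond along `N` to every opponent
move, or fall back on a vertex of `S`; and all infinite `N`-paths are won by `p`. -/
structure MemoryStrategy {V : Type} (G : GameGraph V) (p : Player) (S : Set V) {M : Type}
    (pos : M → V) (N : M → M → Prop) : Prop where
  own : ∀ m, G.owner (pos m) = p →
    ∃ v, G.E (pos m) v ∧ ((∃ m', N m m' ∧ pos m' = v) ∨ v ∈ S)
  opp : ∀ m v, G.owner (pos m) ≠ p → G.E (pos m) v → (∃ m', N m m' ∧ pos m' = v) ∨ v ∈ S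
  won : ∀ path : ℕ → M, (∀ n, N (path n) (path (n + 1))) → G.WonBy p (fun n => pos (path n))

theorem infinite_setOf_add_iff (P : ℕ → Prop) (k : ℕ) :
    {n | P (n + k)}.Infinite ↔ {n | P n}.Infinite := by
  rw [← Nat.frequently_atTop_iff_infinite, ← Nat.frequently_atTop_iff_infinite,
    Filter.frequently_atTop, Filter.frequently_atTop]
  constructor
  · intro h a
    obtain ⟨b, hb, hP⟩ := h a
    exact ⟨b + k, by omega, hP⟩
  · intro h a
    obtain ⟨b, hb, hP⟩ := h (a + k)
    exact ⟨b - k, by omega, by rwa [Nat.sub_add_cancel (by omega)]⟩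

theorem maxInfEven_add_iff (s : ℕ → ℕ) (k : ℕ) :
    MaxInfEven (fun n => s (n + k)) ↔ MaxInfEven s := by
  have h (m : ℕ) : {n | s (n + k) = m}.Infinite ↔ {n | s n = m}.Infinite :=
    infinite_setOf_add_iff (fun n => s n = m) k
  simp only [MaxInfEven, h]

/-- The winner of a play does not depend on a finite initial segment. -/
theorem GameGraph.wonBy_add_iff {V : Type} (G : GameGraph V) (p : Player) (π : ℕ → V) (k : ℕ) :
    G.WonBy p (fun n => π (n + k)) ↔ G.WonBy p π := by
  have h := maxInfEven_add_iff (fun n => G.color (π n)) k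
  cases p
  · exact not_congr h
  · exact h

theorem GameGraph.wonBy_congr {V V' : Type} {G : GameGraph V} {G' : GameGraph V'} {p : Player}
    {π : ℕ → V} {π' : ℕ → V'} (h : ∀ n, G.color (π n) = G'.color (π' n)) :
    G.WonBy p π ↔ G'.WonBy p π' := by
  cases p <;> simp [GameGraph.WonBy, h]

theorem hist_succ {V : Type} (π : ℕ → V) (n : ℕ) : hist π (n + 1) = hist π n ++ [π (n + 1)] := by
  exact List.ofFn_succ_last

theorem hist_zero {V : Type} (π : ℕ → V) : hist π 0 = [π 0] := by
  simp [hist]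

theorem MemoryStrategy.mem_winningRegion_of_empty {V : Type} {G : GameGraph V} {p : Player}
    {M : Type} {pos : M → V} {N : M → M → Prop} (h : MemoryStrategy G p ∅ pos N) (m₀ : M) :
    pos m₀ ∈ WinningRegion G p := by
  classical
  have hown : ∀ m, ∃ m', G.owner (pos m) = p → G.E (pos m) (pos m') ∧ N m m' := by
    intro m
    by_cases hm : G.owner (pos m) = p
    · obtain ⟨v, hv, ⟨m', hN, rfl⟩ | hv'⟩ := h.own m hm
      · exact ⟨m', fun _ => ⟨hv, hN⟩⟩
      · exact hv'.elim
    · exact ⟨m, fun hm' => (hm hm').elim⟩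
  choose c hc using hown
  have hstep : ∀ m v, ∃ m', (∃ m'', N m m'' ∧ pos m'' = v) → N m m' ∧ pos m' = v := by
    intro m v
    by_cases hm : ∃ m'', N m m'' ∧ pos m'' = v
    · exact ⟨hm.choose, fun _ => hm.choose_spec⟩
    · exact ⟨m, fun hm' => (hm hm').elim⟩
  choose step hstep using hstep
  let mem : List V → M := fun l => l.tail.foldl step m₀
  have mem_append (l : List V) (hl : l ≠ []) (v : V) : mem (l ++ [v]) = step (mem l) v := by
    simp [mem, List.tail_append_of_ne_nil hl]
  have ownStep (m : M) (hm : G.owner (pos m) = p) := hstep m (pos (c m)) ⟨c m, (hc m hm).2, rfl⟩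
  have oppStep (m : M) (v : V) (hm : G.owner (pos m) ≠ p) (hv : G.E (pos m) v) :=
    hstep m v ((h.opp m v hm hv).resolve_right (Set.notMem_empty v))
  refine ⟨fun l => pos (c (mem l)), ?_, ?_⟩
  · intro l v hl hlv hv
    have key : l ≠ [] ∧ l.getLast? = some (pos (mem l)) := by
      clear hlv hv
      induction hl with
      | init => simp [mem]
      | ownStep l v _ hlv hv ih =>
        obtain ⟨ih₁, ih₂⟩ := ih
        obtain rfl : v = pos (mem l) := by simpa [hlv] using ih₂
        simp [mem_append l ih₁, (ownStep _ hv).2]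
      | oppStep l v w _ hlv hv hE ih =>
        obtain ⟨ih₁, ih₂⟩ := ih
        obtain rfl : v = pos (mem l) := by simpa [hlv] using ih₂
        simp [mem_append l ih₁, (oppStep _ w hv hE).2]
    obtain rfl : v = pos (mem l) := by simpa [hlv] using key.2
    exact (hc _ hv).1
  · rintro π ⟨hπ₀, hπ⟩ hcons
    have hne (n : ℕ) : hist π n ≠ [] := by simp [hist]
    have hsucc (n : ℕ) : mem (hist π (n + 1)) = step (mem (hist π n)) (π (n + 1)) := by
      rw [hist_succ, mem_append _ (hne n)]
    have hmove (n : ℕ) (hn : pos (mem (hist π n)) = π n) :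
        N (mem (hist π n)) (mem (hist π (n + 1))) ∧ pos (mem (hist π (n + 1))) = π (n + 1) := by
      rw [hsucc]
      by_cases ho : G.owner (π n) = p
      · rw [hcons n ho]
        exact ownStep _ (hn ▸ ho)
      · exact oppStep _ _ (hn ▸ ho) (hn ▸ hπ n)
    have hpos (n : ℕ) : pos (mem (hist π n)) = π n := by
      induction n with
      | zero => simp [hist_zero, mem, hπ₀]
      | succ n ih => exact (hmove n ih).2
    have := h.won (fun n => mem (hist π n)) fun n => (hmove n (hpos n)).1
    simpa only [hpos] using this

theorem exists_memoryStrategy_of_mem_winningRegion {V : Type} {G : GameGraph V} {p : Player}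
    {u : V} (hu : u ∈ WinningRegion G p) :
    ∃ (M : Type) (pos : M → V) (N : M → M → Prop) (m₀ : M),
      MemoryStrategy G p ∅ pos N ∧ pos m₀ = u := by
  obtain ⟨σ, hσ, hwin⟩ := hu
  have hlast : ∀ l, ConsHist G p σ u l → ∃ v, l.getLast? = some v := by
    intro l hl
    cases hl <;> simp
  have : Nonempty V := ⟨u⟩
  choose! last hlast using hlast
  let N : List V → List V → Prop := fun l l' =>
    ∃ v, l' = l ++ [v] ∧ G.E (last l) v ∧ (G.owner (last l) = p → v = σ l)
  let good : List V → Prop := fun l => ConsHist G p σ u l ∧ ∀ path : ℕ → List V, path 0 = l →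
    (∀ n, ConsHist G p σ u (path n)) → (∀ n, N (path n) (path (n + 1))) →
    G.WonBy p (fun n => last (path n))
  have last_append {l : List V} {v : V} (hl : ConsHist G p σ u (l ++ [v])) :
      last (l ++ [v]) = v := by
    simpa using (hlast _ hl).symm
  have good_step {l l' : List V} (hl : good l) (hl' : ConsHist G p σ u l') (hN : N l l') :
      good l' := by
    refine ⟨hl', fun path h₀ hpath hpathN => ?_⟩
    have := hl.2 (fun n => Nat.casesOn n l path) rfl
      (fun n => by cases n; exacts [hl.1, hpath _])
      (fun n => by cases n; exacts [by simpa [h₀] using hN, hpathN _])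
    exact (G.wonBy_add_iff p _ 1).2 this
  have good_init : good [u] := by
    refine ⟨.init, fun path h₀ hpath hpathN => ?_⟩
    have hlast_succ (n : ℕ) : path (n + 1) = path n ++ [last (path (n + 1))] := by
      obtain ⟨v, hv, -⟩ := hpathN n
      have h := hpath (n + 1)
      rw [hv] at h ⊢
      rw [last_append h]
    have last_zero : last (path 0) = u := by
      rw [h₀]
      simpa using (hlast _ ConsHist.init).symm
    have hhist (n : ℕ) : hist (fun n => last (path n)) n = path n := by
      induction n with
      | zero => rw [hist_zero, last_zero, h₀]
      | succ n ih => rw [hist_succ, ih, ← hlast_succ]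
    refine hwin _ ⟨?_, fun n => ?_⟩ fun n hn => ?_
    · exact last_zero
    · obtain ⟨v, hv, hE, -⟩ := hpathN n
      have h := hpath (n + 1)
      rw [hv] at h
      simpa only [hv, last_append h] using hE
    · obtain ⟨v, hv, -, hs⟩ := hpathN n
      have h := hpath (n + 1)
      rw [hv] at h
      simpa only [hv, last_append h, hhist] using hs hn
  refine ⟨{l // good l}, fun l => last l, fun l l' => N l l', ⟨[u], good_init⟩,
    ⟨?_, ?_, ?_⟩, ?_⟩
  · rintro ⟨l, hl⟩ ho
    have hE := hσ l _ hl.1 (hlast l hl.1) ho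
    have hcons := ConsHist.ownStep l _ hl.1 (hlast l hl.1) ho
    have hN : N l (l ++ [σ l]) := ⟨_, rfl, hE, fun _ => rfl⟩
    exact ⟨σ l, hE, .inl ⟨⟨_, good_step hl hcons hN⟩, hN, last_append hcons⟩⟩
  · rintro ⟨l, hl⟩ v ho hE
    have hcons := ConsHist.oppStep l _ v hl.1 (hlast l hl.1) ho hE
    have hN : N l (l ++ [v]) := ⟨_, rfl, hE, fun h => (ho h).elim⟩
    exact .inl ⟨⟨_, good_step hl hcons hN⟩, hN, last_append hcons⟩
  · intro path hpath
    exact (path 0).2.2 (fun n => path n) rfl (fun n => (path n).2.1) hpath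
  · simpa using (hlast _ ConsHist.init).symm

/-- A strategy with memory may fall back on vertices that are already known to be won. -/
theorem MemoryStrategy.mem_winningRegion {V : Type} {G : GameGraph V} {p : Player}
    {M : Type} {pos : M → V} {N : M → M → Prop}
    (h : MemoryStrategy G p (WinningRegion G p) pos N) (m₀ : M) :
    pos m₀ ∈ WinningRegion G p := by
  choose M' pos' N' m' h' hm' using
    fun u : WinningRegion G p => exists_memoryStrategy_of_mem_winningRegion u.2
  let posSum : M ⊕ (Σ u, M' u) → V := Sum.elim pos fun x => pos' x.1 x.2
  let NSum : M ⊕ (Σ u, M' u) → M ⊕ (Σ u, M' u) → Prop := fun a b =>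
    match a, b with
    | .inl a, .inl b => N a b
    | .inl _, .inr _ => True
    | .inr _, .inl _ => False
    | .inr a, .inr b => ∃ x, b = ⟨a.1, x⟩ ∧ N' a.1 a.2 x
  have lift (m : M) (v : V) (hv : (∃ m', N m m' ∧ pos m' = v) ∨ v ∈ WinningRegion G p) :
      ∃ b, NSum (.inl m) b ∧ posSum b = v := by
    rcases hv with ⟨m₁, hN, rfl⟩ | hv
    · exact ⟨.inl m₁, hN, rfl⟩
    · exact ⟨.inr ⟨⟨v, hv⟩, m' _⟩, trivial, hm' ⟨v, hv⟩⟩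
  have hSum : MemoryStrategy G p ∅ posSum NSum := by
    refine ⟨?_, ?_, ?_⟩
    · rintro (m | ⟨u, m⟩) ho
      · obtain ⟨v, hE, hv⟩ := h.own m ho
        exact ⟨v, hE, .inl (lift m v hv)⟩
      · obtain ⟨v, hE, ⟨x, hN, hx⟩ | hv⟩ := (h' u).own m ho
        · exact ⟨v, hE, .inl ⟨.inr ⟨u, x⟩, ⟨x, rfl, hN⟩, hx⟩⟩
        · exact hv.elim
    · rintro (m | ⟨u, m⟩) v ho hE
      · exact .inl (lift m v (h.opp m v ho hE))
      · obtain ⟨x, hN, hx⟩ | hv := (h' u).opp m v ho hE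
        · exact .inl ⟨.inr ⟨u, x⟩, ⟨x, rfl, hN⟩, hx⟩
        · exact hv.elim
    · intro path hpath
      by_cases hr : ∃ k a, path k = .inr a
      · obtain ⟨k, ⟨u, a⟩, hk⟩ := hr
        have hstay (n : ℕ) : ∃ x, path (n + k) = .inr ⟨u, x⟩ := by
          induction n with
          | zero => exact ⟨a, by simpa using hk⟩
          | succ n ih =>
            obtain ⟨x, hx⟩ := ih
            have := hpath (n + k)
            rw [hx] at this
            rw [Nat.add_right_comm]
            rcases hb : path (n + k + 1) with b | b
            · rw [hb] at this
              exact this.elim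
            · rw [hb] at this
              obtain ⟨y, rfl, -⟩ := this
              exact ⟨y, rfl⟩
        choose x hx using hstay
        rw [← G.wonBy_add_iff p _ k]
        simp only [hx]
        refine (h' u).won x fun n => ?_
        have := hpath (n + k)
        rw [Nat.add_right_comm, hx, hx] at this
        obtain ⟨y, hy, hN⟩ := this
        obtain rfl : x (n + 1) = y := by simpa using hy
        exact hN
      · have hl (n : ℕ) : ∃ m, path n = .inl m := by
          rcases hb : path n with b | b
          · exact ⟨b, rfl⟩
          · exact (hr ⟨n, b, hb⟩).elim
        choose x hx using hl
        simp only [hx]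
        refine h.won x fun n => ?_
        have := hpath n
        rwa [hx, hx] at this
  exact hSum.mem_winningRegion_of_empty (.inl m₀)

theorem encode_injective {A Q : Type} : Function.Injective (encode (A := A) (Q := Q)) := by
  rintro ⟨w, q⟩ ⟨w', q'⟩ h
  obtain ⟨h₁, h₂⟩ := List.append_inj' h rfl
  exact Prod.ext (List.map_injective_iff.2 Sum.inl_injective h₁) (by simpa using h₂)

theorem encode_append {A Q : Type} (w x : List A) (q : Q) :
    encode (w ++ x, q) = w.map Sum.inl ++ encode (x, q) := by
  simp [encode]

theorem eq_append_of_encode_eq {A Q : Type} {t : List A × Q} {w : List A} {r : List (A ⊕ Q)}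
    (h : encode t = w.map Sum.inl ++ r) :
    ∃ y q, t = (w ++ y, q) ∧ r = encode (y, q) := by
  induction w generalizing t with
  | nil => exact ⟨t.1, t.2, rfl, by simpa using h.symm⟩
  | cons a w ih =>
    obtain ⟨_ | ⟨b, l⟩, q⟩ := t
    · simp [encode] at h
    · obtain ⟨rfl, h'⟩ : b = a ∧ encode (l, q) = w.map Sum.inl ++ r := by
        simpa [encode] using h
      obtain ⟨y, q', ht, hr⟩ := ih h'
      obtain ⟨rfl, rfl⟩ : l = w ++ y ∧ q = q' := by simpa using ht
      exact ⟨y, q, rfl, hr⟩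

theorem encRel_encode {A Q : Type} (R : (List A × Q) → (List A × Q) → Prop) (u v : List A × Q) :
    encRel R (encode u) (encode v) ↔ R u v := by
  constructor
  · rintro ⟨u', v', hu, hv, h⟩
    rwa [encode_injective hu, encode_injective hv]
  · exact fun h => ⟨u, v, rfl, rfl, h⟩

theorem regularLang_of_isRegular {B : Type} {L : Language B} (h : L.IsRegular) :
    RegularLang (B := B) {x | x ∈ L} := by
  obtain ⟨σ, _, D, rfl⟩ := h
  let e := Fintype.equivFin σ
  refine ⟨Fintype.card σ, e D.start, fun s b => e (D.step (e.symm s) b),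
    {s | e.symm s ∈ D.accept}, fun w => ?_⟩
  have hfold (s : σ) : w.foldl (fun s b => e (D.step (e.symm s) b)) (e s) =
      e (w.foldl D.step s) := by
    induction w generalizing s with
    | nil => rfl
    | cons b w ih => simp [ih]
  rw [hfold]
  simp [DFA.mem_accepts, DFA.eval, DFA.evalFrom]

/-- Myhill–Nerode for sets of encoded vertices: it suffices to bound the number of classes of
stack contents. -/
theorem regularLang_encode_image {A Q P : Type} [Finite P] (S : Set (List A × Q))
    (f : List A → P)
    (hf : ∀ w₁ w₂, f w₁ = f w₂ → ∀ x q, (w₁ ++ x, q) ∈ S → (w₂ ++ x, q) ∈ S) :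
    RegularLang {x : List (A ⊕ Q) | ∃ u ∈ S, x = encode u} := by
  let L : Language (A ⊕ Q) := {x : List (A ⊕ Q) | ∃ u ∈ S, x = encode u}
  refine regularLang_of_isRegular (L := L) (Language.isRegular_iff_finite_range_leftQuotient.2 ?_)
  have hstack (w₁ w₂ : List A) (h : f w₁ = f w₂) :
      L.leftQuotient (w₁.map Sum.inl) ≤ L.leftQuotient (w₂.map Sum.inl) := by
    rintro y ⟨u, hu, hy⟩
    obtain ⟨x, q, rfl, rfl⟩ := eq_append_of_encode_eq hy.symm
    exact ⟨_, hf w₁ w₂ h x q hu, (encode_append _ _ _).symm⟩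
  have hfin : (Set.range fun w : List A => L.leftQuotient (w.map Sum.inl)).Finite := by
    choose g hg using fun y : Set.range fun w : List A => L.leftQuotient (w.map Sum.inl) => y.2
    refine Finite.of_injective (fun y => f (g y)) fun y y' h => Subtype.ext ?_
    rw [← hg y, ← hg y']
    exact le_antisymm (hstack _ _ h) (hstack _ _ h.symm)
  refine (hfin.union (Set.toFinite {(0 : Language (A ⊕ Q)), 1})).subset ?_
  rintro _ ⟨y, rfl⟩
  by_cases hy : ∃ w : List A, y = w.map Sum.inl
  · obtain ⟨w, rfl⟩ := hy
    exact .inl ⟨w, rfl⟩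
  · right
    have hnil (z : List (A ⊕ Q)) (hz : z ∈ L.leftQuotient y) : z = [] := by
      obtain ⟨u, -, hu⟩ := hz
      rcases List.eq_nil_or_concat z with rfl | ⟨z, b, rfl⟩
      · rfl
      · refine (hy ?_).elim
        have h : (y ++ z) ++ [b] = u.1.map Sum.inl ++ [Sum.inr u.2] := by
          simpa [encode] using hu
        obtain ⟨w, -, -, hw, -⟩ := List.append_eq_map_iff.1 (List.append_inj' h rfl).1
        exact ⟨w, hw.symm⟩
    by_cases h : [] ∈ L.leftQuotient y
    · right
      ext z
      exact ⟨fun hz => hnil z hz, fun hz => by rwa [(Language.mem_one z).1 hz]⟩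
    · left
      ext z
      exact ⟨fun hz => h (hnil z hz ▸ hz), fun hz => hz.elim⟩

theorem regularLang_winningRegion {A Q : Type} (qOwner : Q → Player) (qcol : Q → ℕ)
    (E : (List A × Q) → (List A × Q) → Prop) (hpr : PrefixRecognizable (encRel E))
    (p : Player) :
    RegularLang {x : List (A ⊕ Q) |
      ∃ u ∈ WinningRegion (normalGame qOwner qcol E) p, x = encode u} := by
  obtain ⟨k, U, V, W, hreg, hE⟩ := hpr
  choose nU sU δU FU hU using fun i => (hreg i).1
  choose nW sW δW FW hW using fun i => (hreg i).2.2
  set G := normalGame qOwner qcol E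
  let stack : List A → List (A ⊕ Q) := List.map Sum.inl
  -- A jump of type `(i, s)` off the stack `w` leads to one of the vertices in `jump w (i, s)`.
  let jump : List A → (Σ i, Fin (nU i)) → Set (List A × Q) := fun w c =>
    {t | ∃ w' u v, stack w = w' ++ u ∧ w' ∈ W c.1 ∧ u.foldl (δU c.1) (sU c.1) = c.2 ∧
      v ∈ V c.1 ∧ encode t = w' ++ v}
  let profile : List A → ((i : Fin k) → Fin (nW i)) ×
      Set (Σ i, Fin (nU i)) × Set (Σ i, Fin (nU i)) := fun w =>
    (fun i => (stack w).foldl (δW i) (sW i),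
      {c | ∃ t ∈ jump w c, t ∈ WinningRegion G p}, {c | jump w c ⊆ WinningRegion G p})
  have edge_cases {w x : List A} {q : Q} {t : List A × Q} (h : E (w ++ x, q) t) :
      (∃ y q', t = (w ++ y, q') ∧
        ∀ w₂, profile w = profile w₂ → E (w₂ ++ x, q) (w₂ ++ y, q')) ∨
      ∃ c, t ∈ jump w c ∧ ∀ w₂, ∀ t' ∈ jump w₂ c, E (w₂ ++ x, q) t' := by
    obtain ⟨i, w', hw', u, hu, v, hv, h₁, h₂⟩ := (hE _ _).1 ((encRel_encode E _ _).2 h)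
    rw [encode_append] at h₁
    rcases List.append_eq_append_iff.1 h₁ with ⟨z, rfl, hz⟩ | ⟨u', hw, rfl⟩
    · left
      rw [List.append_assoc] at h₂
      obtain ⟨y, q', rfl, hy⟩ := eq_append_of_encode_eq h₂
      refine ⟨y, q', rfl, fun w₂ hP => ?_⟩
      rw [← encRel_encode E, hE]
      have hs : (stack w).foldl (δW i) (sW i) = (stack w₂).foldl (δW i) (sW i) :=
        congrFun (congrArg Prod.fst hP) i
      refine ⟨i, stack w₂ ++ z, ?_, u, hu, v, hv, ?_, ?_⟩
      · rw [hW, List.foldl_append] at hw' ⊢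
        rwa [← hs]
      · rw [encode_append, hz, List.append_assoc]
      · rw [encode_append, ← hy, List.append_assoc]
    · right
      refine ⟨⟨i, u'.foldl (δU i) (sU i)⟩, ⟨w', u', v, hw, hw', rfl, hv, h₂⟩, ?_⟩
      rintro w₂ t' ⟨w'', u'', v', hw₂, hw'', hs, hv', ht'⟩
      rw [← encRel_encode E, hE]
      refine ⟨i, w'', hw'', u'' ++ encode (x, q), ?_, v', hv', ?_, ht'⟩
      · rw [hU, List.foldl_append] at hu ⊢
        exact hs ▸ hu
      · rw [encode_append, ← List.append_assoc, ← hw₂]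
  refine regularLang_encode_image _ profile fun w₁ w₂ hP x₀ q₀ hwin => ?_
  obtain ⟨M, pos, N, m₀, h, hm₀⟩ := exists_memoryStrategy_of_mem_winningRegion hwin
  have hposwin := h.mem_winningRegion_of_empty
  let M₂ := {c : M × List A × Q // pos c.1 = (w₁ ++ c.2.1, c.2.2)}
  have hexists (c) := Set.ext_iff.1 (congrArg (fun P => P.2.1) hP) c
  have hforall (c) := Set.ext_iff.1 (congrArg (fun P => P.2.2) hP) c
  have h₂ : MemoryStrategy G p (WinningRegion G p)
      (fun c : M₂ => (w₂ ++ c.1.2.1, c.1.2.2)) (fun c c' => N c.1.1 c'.1.1) := by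
    refine ⟨?_, ?_, ?_⟩
    · rintro ⟨⟨m, x, q⟩, hm⟩ ho
      obtain ⟨_, hEm, ⟨m', hN, rfl⟩ | hv⟩ := h.own m (by rw [hm]; exact ho)
      · rw [hm] at hEm
        rcases edge_cases hEm with ⟨y, q', ht, hmir⟩ | ⟨c, hc, hjump⟩
        · exact ⟨_, hmir w₂ hP, .inl ⟨⟨⟨m', y, q'⟩, ht⟩, hN, rfl⟩⟩
        · obtain ⟨t', ht', hwin'⟩ := (hexists c).1 ⟨_, hc, hposwin m'⟩
          exact ⟨t', hjump w₂ t' ht', .inr hwin'⟩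
      · exact hv.elim
    · rintro ⟨⟨m, x, q⟩, hm⟩ t ho hEt
      have hopp (v) (hv : E (w₁ ++ x, q) v) : ∃ m', N m m' ∧ pos m' = v :=
        (h.opp m v (by rw [hm]; exact ho) (by rw [hm]; exact hv)).resolve_right
          (Set.notMem_empty v)
      rcases edge_cases hEt with ⟨y, q', rfl, hmir⟩ | ⟨c, hc, hjump⟩
      · obtain ⟨m', hN, hm'⟩ := hopp _ (hmir w₁ hP.symm)
        exact .inl ⟨⟨⟨m', y, q'⟩, hm'⟩, hN, rfl⟩
      · refine .inr ((hforall c).1 (fun t' ht' => ?_) hc)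
        obtain ⟨m', -, rfl⟩ := hopp _ (hjump w₁ t' ht')
        exact hposwin m'
    · intro path hpath
      refine (GameGraph.wonBy_congr fun n => ?_).1 (h.won (fun n => (path n).1.1) hpath)
      rw [(path n).2]
      rfl
  exact h₂.mem_winningRegion ⟨⟨m₀, x₀, q₀⟩, hm₀⟩

/-- For a normal prefix-recognizable parity game graph, the winning regions of both
players are regular languages over `𝔹 = 𝔸 ∪ Q_I ∪ Q_II`. -/
theorem statement9 {A Q : Type} [Finite A] [Finite Q]
    (qOwner : Q → Player) (qcol : Q → ℕ)
    (E : (List A × Q) → (List A × Q) → Prop)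
    (htot : ∀ v, ∃ w, E v w)
    (hpr : PrefixRecognizable (encRel E)) :
    RegularLang {x : List (A ⊕ Q) |
      ∃ u ∈ WinningRegion (normalGame qOwner qcol E) Player.two, x = encode u} ∧
    RegularLang {x : List (A ⊕ Q) |
      ∃ u ∈ WinningRegion (normalGame qOwner qcol E) Player.one, x = encode u} :=
  ⟨regularLang_winningRegion qOwner qcol E hpr Player.two,
    regularLang_winningRegion qOwner qcol E hpr Player.one⟩
end
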